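/- There exists c₂∈(0,+∞) such that for each ε∈(0,1), all g₁,g₂∈Γ_ε and all w∈W_*: ℋ_Γ(g₂M_w) ≤ c₂·ε^{−15d}·ℋ_Γ(g₁M_w). -/

import Mathlib

open MeasureTheory Filter Topology Matrix
open scoped ENNReal NNReal BigOperators

noncomputable section

/-- `D` is an open (round) disk in `ℂ`. -/
def IsOpenDisk (D : Set ℂ) : Prop := ∃ z : ℂ, ∃ r : ℝ, 0 < r ∧ D = Metric.ball z r

/-- `D` is an open half-plane in `ℂ`. -/
def IsOpenHalfPlane (D : Set ℂ) : Prop :=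
  ∃ a : ℂ, a ≠ 0 ∧ ∃ c : ℝ, D = {z : ℂ | (a * z).re < c}

/-- The center of an open disk (junk value otherwise). -/
noncomputable def diskCenter (D : Set ℂ) : ℂ :=
  Classical.epsilon fun z : ℂ => ∃ r : ℝ, 0 < r ∧ D = Metric.ball z r

/-- The radius of an open disk (junk value otherwise). -/
noncomputable def diskRadius (D : Set ℂ) : ℝ :=
  Classical.epsilon fun r : ℝ => 0 < r ∧ ∃ z : ℂ, D = Metric.ball z r

/-- The curvature of `D`: the reciprocal of the radius for an open disk,
and `0` for a half-plane (or anything that is not an open disk). -/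
noncomputable def curv (D : Set ℂ) : ℝ :=
  haveI := Classical.propDecidable (IsOpenDisk D)
  if IsOpenDisk D then (diskRadius D)⁻¹ else 0

/-- A tangential disk triple: each member is an open disk or an open half-plane
(at most one half-plane), and the closures of distinct members meet in exactly one point. -/
def IsTDT (𝒟 : Fin 3 → Set ℂ) : Prop :=
  ((∀ j, IsOpenDisk (𝒟 j)) ∨
    (∃ j, IsOpenHalfPlane (𝒟 j) ∧ ∀ k, k ≠ j → IsOpenDisk (𝒟 k))) ∧
  ∀ j k, j ≠ k → ∃ p : ℂ, closure (𝒟 j) ∩ closure (𝒟 k) = {p}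

/-- The ideal triangle `T(𝒟)`: the unique bounded connected component of
`ℂ ∖ (closure D₁ ∪ closure D₂ ∪ closure D₃)`. -/
noncomputable def idealTriangle (𝒟 : Fin 3 → Set ℂ) : Set ℂ :=
  Classical.epsilon fun T : Set ℂ =>
    Bornology.IsBounded T ∧
    ∃ z ∈ (⋃ j, closure (𝒟 j))ᶜ, T = connectedComponentIn (⋃ j, closure (𝒟 j))ᶜ z

/-- `q_j(𝒟)`: the tangency point of the two members other than the `j`-th one. -/
noncomputable def tangencyPoint (𝒟 : Fin 3 → Set ℂ) (j : Fin 3) : ℂ :=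
  Classical.epsilon fun p : ℂ => closure (𝒟 (j + 1)) ∩ closure (𝒟 (j + 2)) = {p}

/-- `𝒟` is a positively oriented tangential disk triple: the tangency points
`q₁(𝒟), q₂(𝒟), q₃(𝒟)` occur in counterclockwise order, i.e. the ideal triangle
lies to the left of its boundary oriented through `q₁(𝒟), q₂(𝒟), q₃(𝒟)` in this order. -/
def IsTDTplus (𝒟 : Fin 3 → Set ℂ) : Prop :=
  IsTDT 𝒟 ∧
  0 < ((tangencyPoint 𝒟 1 - tangencyPoint 𝒟 0).re *
        (tangencyPoint 𝒟 2 - tangencyPoint 𝒟 0).im -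
       (tangencyPoint 𝒟 1 - tangencyPoint 𝒟 0).im *
        (tangencyPoint 𝒟 2 - tangencyPoint 𝒟 0).re)

/-- `D` is an inscribed disk of the ideal triangle of `𝒟`. -/
def IsInscribedDisk (𝒟 : Fin 3 → Set ℂ) (D : Set ℂ) : Prop :=
  IsOpenDisk D ∧ D ⊆ idealTriangle 𝒟 ∧ ∀ j, ∃ p : ℂ, closure D ∩ closure (𝒟 j) = {p}

/-- The inscribed disk `D_in(𝒟)` of the ideal triangle of `𝒟`. -/
noncomputable def Din (𝒟 : Fin 3 → Set ℂ) : Set ℂ := Classical.epsilon (IsInscribedDisk 𝒟)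

/-- `Φ_j(𝒟)`: replace the `j`-th entry of `𝒟` by the inscribed disk `D_in(𝒟)`. -/
noncomputable def Phi (j : Fin 3) (𝒟 : Fin 3 → Set ℂ) : Fin 3 → Set ℂ :=
  Function.update 𝒟 j (Din 𝒟)

/-- Finite words over the alphabet `{1,2,3}` (represented by `Fin 3`). -/
abbrev Word := List (Fin 3)

/-- `𝒟_w = Φ_w(𝒟) = (Φ_{w_m} ∘ ⋯ ∘ Φ_{w_1})(𝒟)`. -/
noncomputable def applyWord (𝒟 : Fin 3 → Set ℂ) (w : Word) : Fin 3 → Set ℂ :=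
  w.foldl (fun D j => Phi j D) 𝒟

/-- The Apollonian gasket `K(𝒟)` associated with `𝒟`. -/
noncomputable def AG (𝒟 : Fin 3 → Set ℂ) : Set ℂ :=
  closure (idealTriangle 𝒟) \ ⋃ w : Word, Din (applyWord 𝒟 w)

/-- A concrete positively oriented tangential disk triple. -/
noncomputable def baseTriple : Fin 3 → Set ℂ :=
  ![{z : ℂ | 1 < z.im},
    Metric.ball (Complex.I / 2 - 1 / 2) (1 / 2),
    Metric.ball (Complex.I / 2 + 1 / 2) (1 / 2)]

/-- `d`, the Hausdorff dimension of the Apollonian gasket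
(independent of the choice of `𝒟 ∈ TDT⁺`). -/
noncomputable def dAG : ℝ := (dimH (AG baseTriple)).toReal

/-- The matrices `M₁, M₂, M₃`. -/
def Mmat : Fin 3 → Matrix (Fin 4) (Fin 4) ℝ :=
  ![!![1,0,0,0; 1,1,0,1; 1,0,1,1; 2,0,0,1],
    !![1,1,0,1; 0,1,0,0; 0,1,1,1; 0,2,0,1],
    !![1,0,1,1; 0,1,1,1; 0,0,1,0; 0,0,2,1]]

/-- `M_w := M_{w₁} ⋯ M_{w_m}` (`M_∅` is the identity matrix). -/
def Mword (w : Word) : Matrix (Fin 4) (Fin 4) ℝ := (w.map Mmat).prod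

/-- `κ(α,β,γ) := √(βγ + γα + αβ)`. -/
noncomputable def kappa (α β γ : ℝ) : ℝ := Real.sqrt (β * γ + γ * α + α * β)

/-- The row vector `(curv D₁, curv D₂, curv D₃, κ(𝒟))`. -/
noncomputable def curvVec (𝒟 : Fin 3 → Set ℂ) : Fin 4 → ℝ :=
  ![curv (𝒟 0), curv (𝒟 1), curv (𝒟 2),
    kappa (curv (𝒟 0)) (curv (𝒟 1)) (curv (𝒟 2))]

/-- The parameter space `Γ = {(g, κ(g)) : g ∈ [0,∞)³, κ(g) > 0} ⊆ [0,∞)⁴`. -/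
def Gamma : Set (Fin 4 → ℝ) :=
  {g | 0 ≤ g 0 ∧ 0 ≤ g 1 ∧ 0 ≤ g 2 ∧ g 3 = kappa (g 0) (g 1) (g 2) ∧ 0 < g 3}

/-- `Γ° := Γ ∩ (0,∞)⁴`. -/
def GammaInt : Set (Fin 4 → ℝ) := {g | g ∈ Gamma ∧ ∀ i, 0 < g i}

/-- The compact subset `Γ_ε` of `Γ`. -/
def GammaEps (ε : ℝ) : Set (Fin 4 → ℝ) :=
  {g | g 0 ∈ Set.Icc 0 ε⁻¹ ∧ g 1 ∈ Set.Icc 0 ε⁻¹ ∧ g 2 ∈ Set.Icc 0 ε⁻¹ ∧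
       g 3 = kappa (g 0) (g 1) (g 2) ∧
       ε ≤ g 1 + g 2 ∧ ε ≤ g 2 + g 0 ∧ ε ≤ g 0 + g 1}

/-- The Euclidean norm on `ℝ⁴`. -/
noncomputable def euclNorm4 (g : Fin 4 → ℝ) : ℝ := Real.sqrt (∑ i, g i ^ 2)

/-- The metric `ρ_Γ` on `Γ`: the Euclidean distance of the first three coordinates. -/
noncomputable def rhoGamma (g₁ g₂ : Fin 4 → ℝ) : ℝ :=
  Real.sqrt ((g₁ 0 - g₂ 0) ^ 2 + (g₁ 1 - g₂ 1) ^ 2 + (g₁ 2 - g₂ 2) ^ 2)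

/-- A positively oriented tangential disk triple with prescribed curvatures
`(g 0, g 1, g 2)` (junk value if none exists). -/
noncomputable def tripleOf (g : Fin 4 → ℝ) : Fin 3 → Set ℂ :=
  Classical.epsilon fun 𝒟 : Fin 3 → Set ℂ =>
    IsTDTplus 𝒟 ∧ curv (𝒟 0) = g 0 ∧ curv (𝒟 1) = g 1 ∧ curv (𝒟 2) = g 2

/-- `ℋ_Γ(g)`: the `d`-dimensional Hausdorff measure of the Apollonian gasket `K(𝒟)`
for any `𝒟 ∈ TDT⁺` whose members have curvatures `(g 0, g 1, g 2)`. -/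
noncomputable def HGamma (g : Fin 4 → ℝ) : ℝ :=
  (μH[dAG] (AG (tripleOf g))).toReal

/-- The operator norm of a `4 × 4` real matrix with respect to the Euclidean norm on `ℝ⁴`. -/
noncomputable def opNorm4 (M : Matrix (Fin 4) (Fin 4) ℝ) : ℝ :=
  sSup {t : ℝ | ∃ v : Fin 4 → ℝ, euclNorm4 v ≤ 1 ∧ t = euclNorm4 (M.mulVec v)}

/-- The set of words `I = {jⁿk : j,k ∈ S, j ≠ k, n ∈ ℕ}`. -/
def IdxI : Set Word :=
  {w | ∃ j k : Fin 3, j ≠ k ∧ ∃ n : ℕ, 0 < n ∧ w = List.replicate n j ++ [k]}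

end

namespace Apollonian

/-- The value at `z` of the circle form `a|z|² + 2(px + qy) + c` with coefficients
`v = (a, p, q, c)`. -/
noncomputable def circleForm (v : Fin 4 → ℝ) (z : ℂ) : ℝ :=
  v 0 * (z.re ^ 2 + z.im ^ 2) + 2 * (v 1 * z.re + v 2 * z.im) + v 3

/-- The inversive product of two circle forms. -/
noncomputable def inversiveProd (v w : Fin 4 → ℝ) : ℝ :=
  v 1 * w 1 + v 2 * w 2 - (v 0 * w 3 + v 3 * w 0) / 2

/-- The tangency point of two externally tangent generalized disks. -/
noncomputable def touchPoint (v w : Fin 4 → ℝ) : ℂ :=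
  ⟨-(v 1 + w 1) / (v 0 + w 0), -(v 2 + w 2) / (v 0 + w 0)⟩

theorem continuous_circleForm (v : Fin 4 → ℝ) : Continuous (circleForm v) := by
  unfold circleForm
  fun_prop

theorem isOpen_circleForm_neg (v : Fin 4 → ℝ) : IsOpen {z | circleForm v z < 0} :=
  isOpen_lt (continuous_circleForm v) continuous_const

/-- Moving from a zero `z` of a unit form along `s • d`. -/
theorem circleForm_add (v : Fin 4 → ℝ) (z d : ℂ) (s : ℝ) :
    circleForm v (z + s * d) = circleForm v z +
      2 * s * ((v 0 * z.re + v 1) * d.re + (v 0 * z.im + v 2) * d.im) +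
      s ^ 2 * (v 0 * (d.re ^ 2 + d.im ^ 2)) := by
  simp [circleForm]
  ring

/-- If a form decreases to first order from a zero in direction `d`, then it is eventually
negative along `d`. -/
theorem eventually_circleForm_neg {v : Fin 4 → ℝ} {z d : ℂ} (hz : circleForm v z ≤ 0)
    (hd : (v 0 * z.re + v 1) * d.re + (v 0 * z.im + v 2) * d.im < 0) :
    ∀ᶠ s : ℝ in 𝓝[>] 0, circleForm v (z + s * d) < 0 := by
  have hcont : Tendsto (fun s : ℝ =>
      2 * ((v 0 * z.re + v 1) * d.re + (v 0 * z.im + v 2) * d.im) +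
        s * (v 0 * (d.re ^ 2 + d.im ^ 2))) (𝓝[>] 0)
      (𝓝 (2 * ((v 0 * z.re + v 1) * d.re + (v 0 * z.im + v 2) * d.im) +
        0 * (v 0 * (d.re ^ 2 + d.im ^ 2)))) := by
    refine Tendsto.mono_left (Continuous.tendsto ?_ 0) nhdsWithin_le_nhds
    fun_prop
  have hlt := hcont.eventually_lt_const (u := 0) (by linarith)
  filter_upwards [hlt, self_mem_nhdsWithin] with s hs hs0
  rw [circleForm_add]
  have := mul_neg_of_pos_of_neg (Set.mem_Ioi.1 hs0) hs
  nlinarith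

theorem closure_circleForm_neg {v : Fin 4 → ℝ} (hv : inversiveProd v v = 1) :
    closure {z | circleForm v z < 0} = {z | circleForm v z ≤ 0} := by
  apply Set.Subset.antisymm
  · exact closure_minimal (fun z (hz : circleForm v z < 0) => hz.le)
      (isClosed_le (continuous_circleForm v) continuous_const)
  · intro z hz
    rcases lt_or_eq_of_le (show circleForm v z ≤ 0 from hz) with h | h
    · exact subset_closure h
    have hd : (v 0 * z.re + v 1) * (-(v 0 * z.re + v 1)) +
        (v 0 * z.im + v 2) * (-(v 0 * z.im + v 2)) < 0 := by
      unfold circleForm at h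
      unfold inversiveProd at hv
      have : (v 0 * z.re + v 1) * (-(v 0 * z.re + v 1)) +
        (v 0 * z.im + v 2) * (-(v 0 * z.im + v 2)) = -1 := by
        linear_combination -v 0 * h - hv
      linarith
    have hev := eventually_circleForm_neg (v := v) (z := z)
      (d := ⟨-(v 0 * z.re + v 1), -(v 0 * z.im + v 2)⟩) h.le hd
    have htend : Tendsto (fun s : ℝ => z + s * (⟨-(v 0 * z.re + v 1), -(v 0 * z.im + v 2)⟩ : ℂ))
        (𝓝[>] 0) (𝓝 (z + (0 : ℝ) * (⟨-(v 0 * z.re + v 1), -(v 0 * z.im + v 2)⟩ : ℂ))) := by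
      refine Tendsto.mono_left (Continuous.tendsto ?_ 0) nhdsWithin_le_nhds
      fun_prop
    simp only [Complex.ofReal_zero, zero_mul, add_zero] at htend
    exact mem_closure_of_tendsto htend hev

theorem circleForm_eq_of_pos {v : Fin 4 → ℝ} (h0 : 0 < v 0) (z : ℂ) :
    circleForm v z = v 0 * ((z.re + v 1 / v 0) ^ 2 + (z.im + v 2 / v 0) ^ 2) -
      inversiveProd v v / v 0 := by
  unfold circleForm inversiveProd
  field_simp
  ring

theorem circleForm_neg_eq_ball {v : Fin 4 → ℝ} (hv : inversiveProd v v = 1) (h0 : 0 < v 0) :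
    {z | circleForm v z < 0} = Metric.ball (⟨-v 1 / v 0, -v 2 / v 0⟩ : ℂ) (v 0)⁻¹ := by
  ext z
  rw [Set.mem_ofPred_eq, circleForm_eq_of_pos h0, hv, Metric.mem_ball, Complex.dist_eq,
    Complex.norm_def, Real.sqrt_lt' (by positivity), Complex.normSq_apply]
  simp only [Complex.sub_re, Complex.sub_im]
  constructor
  · intro h
    have : ((z.re + v 1 / v 0) ^ 2 + (z.im + v 2 / v 0) ^ 2) < (v 0)⁻¹ / v 0 := by
      rw [lt_div_iff₀ h0]
      rw [one_div] at h
      linarith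
    calc _ = ((z.re + v 1 / v 0) ^ 2 + (z.im + v 2 / v 0) ^ 2) := by ring
      _ < _ := this
      _ = _ := by ring
  · intro h
    have : ((z.re + v 1 / v 0) ^ 2 + (z.im + v 2 / v 0) ^ 2) < (v 0)⁻¹ / v 0 := by
      calc _ = _ := by ring
        _ < _ := h
        _ = _ := by ring
    rw [lt_div_iff₀ h0] at this
    rw [one_div]
    linarith

theorem ball_eq_circleForm_neg (z : ℂ) {r : ℝ} (hr : 0 < r) :
    ∃ v : Fin 4 → ℝ, v 0 = r⁻¹ ∧ inversiveProd v v = 1 ∧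
      Metric.ball z r = {w | circleForm v w < 0} := by
  have hv : inversiveProd ![r⁻¹, -z.re / r, -z.im / r, (z.re ^ 2 + z.im ^ 2 - r ^ 2) / r]
      ![r⁻¹, -z.re / r, -z.im / r, (z.re ^ 2 + z.im ^ 2 - r ^ 2) / r] = 1 := by
    simp [inversiveProd]
    field_simp
    ring
  refine ⟨_, rfl, hv, ?_⟩
  rw [circleForm_neg_eq_ball hv (by simpa using hr)]
  congr 1
  · apply Complex.ext <;> simp <;> field_simp
  · simp

theorem halfPlane_eq_circleForm_neg {D : Set ℂ} (hD : IsOpenHalfPlane D) :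
    ∃ v : Fin 4 → ℝ, v 0 = 0 ∧ inversiveProd v v = 1 ∧ D = {w | circleForm v w < 0} := by
  obtain ⟨a, ha, c, rfl⟩ := hD
  have hn : 0 < ‖a‖ := norm_pos_iff.2 ha
  have hsq : ‖a‖ ^ 2 = a.re ^ 2 + a.im ^ 2 := by
    rw [← Complex.normSq_eq_norm_sq, Complex.normSq_apply]; ring
  refine ⟨![0, a.re / ‖a‖, -a.im / ‖a‖, -2 * c / ‖a‖], rfl, ?_, ?_⟩
  · simp [inversiveProd]
    field_simp
    linarith
  · ext z
    have : circleForm ![0, a.re / ‖a‖, -a.im / ‖a‖, -2 * c / ‖a‖] z =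
        2 / ‖a‖ * ((a * z).re - c) := by
      simp [circleForm]
      ring
    rw [Set.mem_ofPred_eq, Set.mem_ofPred_eq, this]
    have hp : 0 < 2 / ‖a‖ := by positivity
    rw [mul_neg_iff]
    constructor
    · intro h; left; exact ⟨hp, by linarith⟩
    · rintro (h | h) <;> linarith [h.1, h.2]

theorem isOpenHalfPlane_of_zero {v : Fin 4 → ℝ} (hv : inversiveProd v v = 1) (h0 : v 0 = 0) :
    IsOpenHalfPlane {z | circleForm v z < 0} := by
  refine ⟨⟨v 1, -v 2⟩, ?_, -v 3 / 2, ?_⟩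
  · intro h
    have h1 := congrArg Complex.re h
    have h2 := congrArg Complex.im h
    simp at h1 h2
    simp [inversiveProd, h0, h1, h2] at hv
  · ext z
    simp only [circleForm, h0, Set.mem_ofPred_eq, Complex.mul_re]
    constructor <;> intro h <;> linarith

theorem radius_eq_of_ball_eq {z z' : ℂ} {r r' : ℝ} (hr : 0 < r) (hr' : 0 < r')
    (h : Metric.ball z r = Metric.ball z' r') : r = r' := by
  have h1 := congrArg Metric.diam h
  rw [Metric.diam_ball_eq _ hr.le, Metric.diam_ball_eq _ hr'.le] at h1
  linarith

theorem curv_ball (z : ℂ) {r : ℝ} (hr : 0 < r) : curv (Metric.ball z r) = r⁻¹ := by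
  have hD : IsOpenDisk (Metric.ball z r) := ⟨z, r, hr, rfl⟩
  have hspec : 0 < diskRadius (Metric.ball z r) ∧
      ∃ z' : ℂ, Metric.ball z r = Metric.ball z' (diskRadius (Metric.ball z r)) :=
    Classical.epsilon_spec
      (p := fun s : ℝ => 0 < s ∧ ∃ z' : ℂ, Metric.ball z r = Metric.ball z' s) ⟨r, hr, z, rfl⟩
  obtain ⟨hpos, z', hz'⟩ := hspec
  rw [curv, if_pos hD, ← radius_eq_of_ball_eq hr hpos hz']

theorem curv_of_pos {v : Fin 4 → ℝ} (hv : inversiveProd v v = 1) (h0 : 0 < v 0) :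
    curv {z | circleForm v z < 0} = v 0 := by
  rw [circleForm_neg_eq_ball hv h0, curv_ball _ (by positivity), inv_inv]

theorem isOpenDisk_of_pos {v : Fin 4 → ℝ} (hv : inversiveProd v v = 1) (h0 : 0 < v 0) :
    IsOpenDisk {z | circleForm v z < 0} :=
  ⟨_, _, by positivity, circleForm_neg_eq_ball hv h0⟩

theorem curv_of_zero {v : Fin 4 → ℝ} (hv : inversiveProd v v = 1) (h0 : v 0 = 0) :
    curv {z | circleForm v z < 0} = v 0 := by
  rw [curv, if_neg, h0]
  rintro ⟨z, r, -, hz⟩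
  have hb : Bornology.IsBounded {z | circleForm v z < 0} := hz ▸ Metric.isBounded_ball
  obtain ⟨R, hR⟩ := hb.exists_norm_le
  have hn : v 1 ^ 2 + v 2 ^ 2 = 1 := by
    simp only [inversiveProd, h0] at hv
    linarith
  set t : ℝ := |R| + |v 3| + 1
  have ht : R < t := by
    have := le_abs_self R
    have := abs_nonneg (v 3)
    simp only [t]; linarith
  have ht0 : 0 < t := by positivity
  have h1 := hR (⟨-t * v 1, -t * v 2⟩ : ℂ) (by
    simp only [Set.mem_ofPred_eq, circleForm, h0]
    have := le_abs_self (v 3)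
    have := abs_nonneg R
    have h2 : 0 * ((-t * v 1) ^ 2 + (-t * v 2) ^ 2) + 2 * (v 1 * (-t * v 1) + v 2 * (-t * v 2))
      + v 3 = - 2 * t + v 3 := by linear_combination (-2 * t) * hn
    rw [h2]
    simp only [t]
    have := abs_nonneg (v 3)
    linarith)
  rw [Complex.norm_def, Complex.normSq_apply] at h1
  have h3 : (-t * v 1) * (-t * v 1) + (-t * v 2) * (-t * v 2) = t ^ 2 := by
    linear_combination t ^ 2 * hn
  simp only [h3, Real.sqrt_sq ht0.le] at h1
  linarith

theorem curv_circleForm {v : Fin 4 → ℝ} (hv : inversiveProd v v = 1) (h0 : 0 ≤ v 0) :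
    curv {z | circleForm v z < 0} = v 0 := by
  rcases h0.lt_or_eq with h | h
  · exact curv_of_pos hv h
  · exact curv_of_zero hv h.symm

theorem inter_eq_touchPoint {v w : Fin 4 → ℝ} (hv : inversiveProd v v = 1)
    (hw : inversiveProd w w = 1) (hvw : inversiveProd v w = -1) (h0 : 0 < v 0 + w 0) :
    closure {z | circleForm v z < 0} ∩ closure {z | circleForm w z < 0} = {touchPoint v w} := by
  rw [closure_circleForm_neg hv, closure_circleForm_neg hw]
  have hsum : ∀ z : ℂ, circleForm v z + circleForm w z = (v 0 + w 0) *
      ((z.re - (touchPoint v w).re) ^ 2 + (z.im - (touchPoint v w).im) ^ 2) := by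
    intro z
    simp only [circleForm, touchPoint]
    simp only [inversiveProd] at hv hw hvw
    field_simp
    linear_combination (-1 : ℝ) * hv - hw - 2 * hvw
  have hzero : ∀ {v w : Fin 4 → ℝ}, inversiveProd v v = 1 → inversiveProd w w = 1 →
      inversiveProd v w = -1 → 0 < v 0 + w 0 → circleForm v (touchPoint v w) = 0 := by
    intro v w hv hw hvw h0
    simp only [circleForm, touchPoint]
    simp only [inversiveProd] at hv hw hvw
    field_simp
    linear_combination (-v 0 - 2 * w 0) * hv + v 0 * hw - 2 * w 0 * hvw
  ext z
  simp only [Set.mem_inter_iff, Set.mem_ofPred_eq, Set.mem_singleton_iff]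
  constructor
  · rintro ⟨h1, h2⟩
    have h3 := hsum z
    have h4 : (z.re - (touchPoint v w).re) ^ 2 + (z.im - (touchPoint v w).im) ^ 2 ≤ 0 := by
      by_contra! h
      have := mul_pos h0 h
      linarith
    apply Complex.ext <;> nlinarith [sq_nonneg (z.re - (touchPoint v w).re),
      sq_nonneg (z.im - (touchPoint v w).im)]
  · rintro rfl
    have h1 := hzero hv hw hvw h0
    have h2 := hsum (touchPoint v w)
    simp only [sub_self] at h2
    exact ⟨h1.le, by linarith⟩

theorem inversiveProd_eq_neg_one {v w : Fin 4 → ℝ} (hv : inversiveProd v v = 1)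
    (hw : inversiveProd w w = 1)
    (h : ∃ p, closure {z | circleForm v z < 0} ∩ closure {z | circleForm w z < 0} = {p}) :
    inversiveProd v w = -1 := by
  obtain ⟨p, hp⟩ := h
  have hdisj : ∀ z, circleForm v z < 0 → ¬ circleForm w z < 0 := by
    intro z hz hz'
    have hopen := (isOpen_circleForm_neg v).inter (isOpen_circleForm_neg w)
    have hsub : {z | circleForm v z < 0} ∩ {z | circleForm w z < 0} ⊆ {p} := by
      rw [← hp]
      exact Set.inter_subset_inter subset_closure subset_closure
    have hne : ({z | circleForm v z < 0} ∩ {z | circleForm w z < 0}).Nonempty := ⟨z, hz, hz'⟩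
    have hEq : {z | circleForm v z < 0} ∩ {z | circleForm w z < 0} = {p} :=
      hne.subset_singleton_iff.1 hsub
    rw [hEq] at hopen
    exact not_isOpen_singleton p hopen
  have hmem : p ∈ closure {z | circleForm v z < 0} ∩ closure {z | circleForm w z < 0} := by
    rw [hp]; rfl
  have hpv : circleForm v p = 0 := by
    refine le_antisymm ?_ ?_
    · have := hmem.1; rw [closure_circleForm_neg hv] at this; exact this
    · by_contra! hlt
      obtain ⟨z, hz, hz'⟩ := mem_closure_iff.1 hmem.2 _ (isOpen_circleForm_neg v) hlt
      exact hdisj z hz hz'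
  have hpw : circleForm w p = 0 := by
    refine le_antisymm ?_ ?_
    · have := hmem.2; rw [closure_circleForm_neg hw] at this; exact this
    · by_contra! hlt
      obtain ⟨z, hz, hz'⟩ := mem_closure_iff.1 hmem.1 _ (isOpen_circleForm_neg w) hlt
      exact hdisj z hz' hz
  have hnv : (v 0 * p.re + v 1) ^ 2 + (v 0 * p.im + v 2) ^ 2 = 1 := by
    unfold circleForm at hpv
    unfold inversiveProd at hv
    linear_combination v 0 * hpv + hv
  have hnw : (w 0 * p.re + w 1) ^ 2 + (w 0 * p.im + w 2) ^ 2 = 1 := by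
    unfold circleForm at hpw
    unfold inversiveProd at hw
    linear_combination w 0 * hpw + hw
  have hprod : inversiveProd v w = (v 0 * p.re + v 1) * (w 0 * p.re + w 1) +
      (v 0 * p.im + v 2) * (w 0 * p.im + w 2) := by
    unfold circleForm at hpv hpw
    unfold inversiveProd
    linear_combination (-v 0 / 2) * hpw - w 0 / 2 * hpv
  rw [hprod]
  by_contra hne
  have hgt : -1 < (v 0 * p.re + v 1) * (w 0 * p.re + w 1) +
      (v 0 * p.im + v 2) * (w 0 * p.im + w 2) := by
    refine lt_of_le_of_ne ?_ (Ne.symm hne)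
    nlinarith [sq_nonneg (v 0 * p.re + v 1 + (w 0 * p.re + w 1)),
      sq_nonneg (v 0 * p.im + v 2 + (w 0 * p.im + w 2))]
  have h1 := eventually_circleForm_neg (v := v) (z := p)
    (d := ⟨-(v 0 * p.re + v 1 + (w 0 * p.re + w 1)), -(v 0 * p.im + v 2 + (w 0 * p.im + w 2))⟩)
    hpv.le (by simp only; nlinarith)
  have h2 := eventually_circleForm_neg (v := w) (z := p)
    (d := ⟨-(v 0 * p.re + v 1 + (w 0 * p.re + w 1)), -(v 0 * p.im + v 2 + (w 0 * p.im + w 2))⟩)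
    hpw.le (by simp only; nlinarith)
  obtain ⟨s, hs1, hs2⟩ := (h1.and h2).exists
  exact hdisj _ hs1 hs2

/-- The matrix of the inversive product on circle forms. -/
noncomputable def formMat : Matrix (Fin 4) (Fin 4) ℝ :=
  !![0,0,0,-1/2; 0,1,0,0; 0,0,1,0; -1/2,0,0,0]

/-- The Gram matrix of three pairwise tangent circles and their common orthogonal circle. -/
def gramMat : Matrix (Fin 4) (Fin 4) ℝ :=
  !![1,-1,-1,0; -1,1,-1,0; -1,-1,1,0; 0,0,0,1]

/-- The polarization of twice the Descartes form `x₀x₁ + x₁x₂ + x₂x₀ - x₃²`. -/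
def descartesForm (x y : Fin 4 → ℝ) : ℝ :=
  x 0 * (y 1 + y 2) + x 1 * (y 0 + y 2) + x 2 * (y 0 + y 1) - 2 * (x 3 * y 3)

/-- The rows of `F` are three pairwise tangent circle forms of nonnegative curvature,
followed by the form of the circle through their tangency points. -/
structure IsFrame (F : Matrix (Fin 4) (Fin 4) ℝ) : Prop where
  gram : F * formMat * Fᵀ = gramMat
  nonneg : ∀ i, 0 ≤ F i 0
  pos : 0 < F 3 0

/-- The values at `z` of the four circle forms of a frame. -/
noncomputable def coords (F : Matrix (Fin 4) (Fin 4) ℝ) (z : ℂ) : Fin 4 → ℝ :=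
  fun i => circleForm (F i) z

theorem coords_eq_mulVec (F : Matrix (Fin 4) (Fin 4) ℝ) (z : ℂ) :
    coords F z = F *ᵥ ![z.re ^ 2 + z.im ^ 2, 2 * z.re, 2 * z.im, 1] := by
  ext i
  simp [coords, circleForm, Matrix.mulVec, dotProduct, Fin.sum_univ_four]
  ring

theorem coords_transpose_mul (M F : Matrix (Fin 4) (Fin 4) ℝ) (z : ℂ) :
    coords (Mᵀ * F) z = coords F z ᵥ* M := by
  rw [coords_eq_mulVec, coords_eq_mulVec, ← Matrix.mulVec_mulVec, Matrix.mulVec_transpose]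

theorem inversiveProd_eq (F : Matrix (Fin 4) (Fin 4) ℝ) (i j : Fin 4) :
    inversiveProd (F i) (F j) = (F * formMat * Fᵀ) i j := by
  simp [inversiveProd, formMat, Matrix.mul_apply, Fin.sum_univ_four]
  ring

theorem IsFrame.inversiveProd_row {F : Matrix (Fin 4) (Fin 4) ℝ} (hF : IsFrame F) (i j : Fin 4) :
    inversiveProd (F i) (F j) = gramMat i j := by
  rw [inversiveProd_eq, hF.gram]

theorem IsFrame.diag {F : Matrix (Fin 4) (Fin 4) ℝ} (hF : IsFrame F) (i : Fin 4) :
    inversiveProd (F i) (F i) = 1 := by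
  rw [hF.inversiveProd_row]
  fin_cases i <;> simp [gramMat]

/-- The inverse of `gramMat`. -/
noncomputable def gramInv : Matrix (Fin 4) (Fin 4) ℝ :=
  !![0,-1/2,-1/2,0; -1/2,0,-1/2,0; -1/2,-1/2,0,0; 0,0,0,1]

/-- The inverse of `formMat`. -/
def formInv : Matrix (Fin 4) (Fin 4) ℝ :=
  !![0,0,0,-2; 0,1,0,0; 0,0,1,0; -2,0,0,0]

theorem gramMat_mul_gramInv : gramMat * gramInv = 1 := by
  ext i j
  fin_cases i <;> fin_cases j <;>
    simp [gramMat, gramInv, Matrix.mul_apply, Fin.sum_univ_four] <;> norm_num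

theorem formInv_mul_formMat : formInv * formMat = 1 := by
  ext i j
  fin_cases i <;> fin_cases j <;>
    simp [formMat, formInv, Matrix.mul_apply, Fin.sum_univ_four] <;> norm_num

theorem formMat_mul_of_gram {F : Matrix (Fin 4) (Fin 4) ℝ} (h : F * formMat * Fᵀ = gramMat) :
    formMat * (Fᵀ * gramInv * F) = 1 := by
  have h1 : F * (formMat * Fᵀ * gramInv) = 1 := by
    rw [← gramMat_mul_gramInv, ← h]
    simp only [Matrix.mul_assoc]
  simpa only [Matrix.mul_assoc] using mul_eq_one_comm.1 h1

theorem dual_of_gram {F : Matrix (Fin 4) (Fin 4) ℝ} (h : F * formMat * Fᵀ = gramMat) :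
    Fᵀ * gramInv * F = formInv := by
  calc Fᵀ * gramInv * F = (formInv * formMat) * (Fᵀ * gramInv * F) := by
        rw [formInv_mul_formMat, Matrix.one_mul]
    _ = formInv := by rw [Matrix.mul_assoc, formMat_mul_of_gram h, Matrix.mul_one]

theorem descartesForm_col_of_gram {F : Matrix (Fin 4) (Fin 4) ℝ}
    (h : F * formMat * Fᵀ = gramMat) (k l : Fin 4) :
    descartesForm (Fᵀ k) (Fᵀ l) = -2 * formInv k l := by
  rw [← dual_of_gram h]
  simp [descartesForm, gramInv, Matrix.mul_apply, Fin.sum_univ_four]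
  ring

theorem curv_sq_of_gram {F : Matrix (Fin 4) (Fin 4) ℝ} (h : F * formMat * Fᵀ = gramMat) :
    F 3 0 ^ 2 = F 0 0 * F 1 0 + F 1 0 * F 2 0 + F 2 0 * F 0 0 := by
  have h := descartesForm_col_of_gram h 0 0
  simp only [descartesForm, Matrix.transpose_apply] at h
  simp [formInv] at h
  linarith

namespace IsFrame

variable {F : Matrix (Fin 4) (Fin 4) ℝ}

theorem descartesForm_col (hF : IsFrame F) (k l : Fin 4) :
    descartesForm (Fᵀ k) (Fᵀ l) = -2 * formInv k l :=
  descartesForm_col_of_gram hF.gram k l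

theorem coords_eq_cols (z : ℂ) (i : Fin 4) : coords F z i =
    (z.re ^ 2 + z.im ^ 2) * Fᵀ 0 i + 2 * z.re * Fᵀ 1 i + 2 * z.im * Fᵀ 2 i + Fᵀ 3 i := by
  simp [coords, circleForm]
  ring

theorem descartesForm_coords (hF : IsFrame F) (z w : ℂ) :
    descartesForm (coords F z) (coords F w) = 4 * ((z.re - w.re) ^ 2 + (z.im - w.im) ^ 2) := by
  have h : descartesForm (coords F z) (coords F w) =
      (z.re ^ 2 + z.im ^ 2) * ((w.re ^ 2 + w.im ^ 2) * descartesForm (Fᵀ 0) (Fᵀ 0) +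
        2 * w.re * descartesForm (Fᵀ 0) (Fᵀ 1) + 2 * w.im * descartesForm (Fᵀ 0) (Fᵀ 2) +
        descartesForm (Fᵀ 0) (Fᵀ 3)) +
      2 * z.re * ((w.re ^ 2 + w.im ^ 2) * descartesForm (Fᵀ 1) (Fᵀ 0) +
        2 * w.re * descartesForm (Fᵀ 1) (Fᵀ 1) + 2 * w.im * descartesForm (Fᵀ 1) (Fᵀ 2) +
        descartesForm (Fᵀ 1) (Fᵀ 3)) +
      2 * z.im * ((w.re ^ 2 + w.im ^ 2) * descartesForm (Fᵀ 2) (Fᵀ 0) +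
        2 * w.re * descartesForm (Fᵀ 2) (Fᵀ 1) + 2 * w.im * descartesForm (Fᵀ 2) (Fᵀ 2) +
        descartesForm (Fᵀ 2) (Fᵀ 3)) +
      ((w.re ^ 2 + w.im ^ 2) * descartesForm (Fᵀ 3) (Fᵀ 0) +
        2 * w.re * descartesForm (Fᵀ 3) (Fᵀ 1) + 2 * w.im * descartesForm (Fᵀ 3) (Fᵀ 2) +
        descartesForm (Fᵀ 3) (Fᵀ 3)) := by
    simp only [descartesForm, coords_eq_cols]
    ring
  rw [h]
  simp only [hF.descartesForm_col]
  simp [formInv]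
  ring

theorem descartesForm_coords_col (hF : IsFrame F) (z : ℂ) (k : Fin 4) :
    descartesForm (coords F z) (Fᵀ k) = -2 * ((z.re ^ 2 + z.im ^ 2) * formInv 0 k +
      2 * z.re * formInv 1 k + 2 * z.im * formInv 2 k + formInv 3 k) := by
  have h : descartesForm (coords F z) (Fᵀ k) =
      (z.re ^ 2 + z.im ^ 2) * descartesForm (Fᵀ 0) (Fᵀ k) +
      2 * z.re * descartesForm (Fᵀ 1) (Fᵀ k) + 2 * z.im * descartesForm (Fᵀ 2) (Fᵀ k) +
      descartesForm (Fᵀ 3) (Fᵀ k) := by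
    simp only [descartesForm, coords_eq_cols]
    ring
  rw [h]
  simp only [hF.descartesForm_col]
  ring

theorem descartesForm_coords_zero (hF : IsFrame F) (z : ℂ) :
    descartesForm (coords F z) (Fᵀ 0) = 4 := by
  rw [hF.descartesForm_coords_col]
  simp [formInv]
  norm_num

theorem descartesForm_coords_self (hF : IsFrame F) (z : ℂ) :
    descartesForm (coords F z) (coords F z) = 0 := by
  rw [hF.descartesForm_coords]
  ring

/-- Every vector is recovered from its products with the columns of a frame. -/
theorem expand (hF : IsFrame F) (x : Fin 4 → ℝ) (i : Fin 4) :
    x i = descartesForm x (Fᵀ 3) / 4 * F i 0 - descartesForm x (Fᵀ 1) / 2 * F i 1 -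
      descartesForm x (Fᵀ 2) / 2 * F i 2 + descartesForm x (Fᵀ 0) / 4 * F i 3 := by
  have h0 := hF.inversiveProd_row i 0
  have h1 := hF.inversiveProd_row i 1
  have h2 := hF.inversiveProd_row i 2
  have h3 := hF.inversiveProd_row i 3
  have hx : x i = -(1 / 2) * ((x 1 + x 2) * gramMat i 0 + (x 0 + x 2) * gramMat i 1 +
      (x 0 + x 1) * gramMat i 2 - 2 * x 3 * gramMat i 3) := by
    fin_cases i <;> simp [gramMat] <;> ring
  rw [hx, ← h0, ← h1, ← h2, ← h3]
  simp only [descartesForm, inversiveProd, Matrix.transpose_apply]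
  ring

end IsFrame

/-- The point of the plane whose coordinates in the frame `F` are proportional to `x`. -/
noncomputable def pointOf (F : Matrix (Fin 4) (Fin 4) ℝ) (x : Fin 4 → ℝ) : ℂ :=
  ⟨-descartesForm x (Fᵀ 1) / descartesForm x (Fᵀ 0),
    -descartesForm x (Fᵀ 2) / descartesForm x (Fᵀ 0)⟩

theorem descartesForm_smul (t : ℝ) (x y : Fin 4 → ℝ) :
    descartesForm (t • x) y = t * descartesForm x y := by
  simp only [descartesForm, Pi.smul_apply, smul_eq_mul]
  ring

theorem descartesForm_smul_right (t : ℝ) (x y : Fin 4 → ℝ) :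
    descartesForm x (t • y) = t * descartesForm x y := by
  simp only [descartesForm, Pi.smul_apply, smul_eq_mul]
  ring

theorem pointOf_smul (F : Matrix (Fin 4) (Fin 4) ℝ) {t : ℝ} (ht : t ≠ 0) (x : Fin 4 → ℝ) :
    pointOf F (t • x) = pointOf F x := by
  simp only [pointOf, descartesForm_smul, ← mul_neg, mul_div_mul_left _ _ ht]

namespace IsFrame

variable {F : Matrix (Fin 4) (Fin 4) ℝ}

theorem pointOf_coords (hF : IsFrame F) (z : ℂ) : pointOf F (coords F z) = z := by
  simp only [pointOf, hF.descartesForm_coords_col]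
  apply Complex.ext <;> simp [formInv] <;> ring

theorem coords_pointOf (hF : IsFrame F) {x : Fin 4 → ℝ} (hx : descartesForm x x = 0)
    (h0 : descartesForm x (Fᵀ 0) ≠ 0) :
    coords F (pointOf F x) = (4 / descartesForm x (Fᵀ 0)) • x := by
  have hnull : descartesForm x (Fᵀ 0) * descartesForm x (Fᵀ 3) =
      descartesForm x (Fᵀ 1) ^ 2 + descartesForm x (Fᵀ 2) ^ 2 := by
    have h : descartesForm x x = descartesForm x (Fᵀ 3) / 4 * descartesForm x (Fᵀ 0) -
        descartesForm x (Fᵀ 1) / 2 * descartesForm x (Fᵀ 1) -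
        descartesForm x (Fᵀ 2) / 2 * descartesForm x (Fᵀ 2) +
        descartesForm x (Fᵀ 0) / 4 * descartesForm x (Fᵀ 3) := by
      conv_lhs => rw [descartesForm]
      rw [hF.expand x 0, hF.expand x 1, hF.expand x 2, hF.expand x 3]
      generalize hp : descartesForm x (Fᵀ 0) = p
      generalize hq : descartesForm x (Fᵀ 1) = q
      generalize hr : descartesForm x (Fᵀ 2) = r
      generalize hs : descartesForm x (Fᵀ 3) = s
      have h00 := hF.descartesForm_col 0 0
      have h01 := hF.descartesForm_col 0 1
      have h02 := hF.descartesForm_col 0 2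
      have h03 := hF.descartesForm_col 0 3
      have h11 := hF.descartesForm_col 1 1
      have h12 := hF.descartesForm_col 1 2
      have h13 := hF.descartesForm_col 1 3
      have h22 := hF.descartesForm_col 2 2
      have h23 := hF.descartesForm_col 2 3
      have h33 := hF.descartesForm_col 3 3
      simp [formInv, descartesForm] at h00 h01 h02 h03 h11 h12 h13 h22 h23 h33
      linear_combination s ^ 2 / 16 * h00 - 2 * (s * q / 8) * h01 - 2 * (s * r / 8) * h02 +
        2 * (s * p / 16) * h03 + q ^ 2 / 4 * h11 + 2 * (q * r / 4) * h12 - 2 * (q * p / 8) * h13 +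
        r ^ 2 / 4 * h22 - 2 * (r * p / 8) * h23 + p ^ 2 / 16 * h33
    rw [hx] at h
    linear_combination -2 * h
  ext i
  rw [Pi.smul_apply, smul_eq_mul, hF.expand x i]
  simp only [coords, circleForm, pointOf]
  field_simp
  linear_combination (-2 : ℝ) * F i 0 * hnull

theorem curv_sq (hF : IsFrame F) :
    F 3 0 ^ 2 = F 0 0 * F 1 0 + F 1 0 * F 2 0 + F 2 0 * F 0 0 :=
  curv_sq_of_gram hF.gram

theorem curv_add_pos (hF : IsFrame F) :
    0 < F 0 0 + F 1 0 ∧ 0 < F 1 0 + F 2 0 ∧ 0 < F 2 0 + F 0 0 := by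
  have h := hF.curv_sq
  have h0 := hF.nonneg 0
  have h1 := hF.nonneg 1
  have h2 := hF.nonneg 2
  have h3 := pow_pos hF.pos 2
  refine ⟨?_, ?_, ?_⟩ <;> by_contra! hneg
  · have e0 : F 0 0 = 0 := by linarith
    have e1 : F 1 0 = 0 := by linarith
    rw [e0, e1] at h; linarith
  · have e0 : F 1 0 = 0 := by linarith
    have e1 : F 2 0 = 0 := by linarith
    rw [e0, e1] at h; linarith
  · have e0 : F 2 0 = 0 := by linarith
    have e1 : F 0 0 = 0 := by linarith
    rw [e0, e1] at h; linarith

theorem coords_sq (hF : IsFrame F) (z : ℂ) : coords F z 3 ^ 2 =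
    coords F z 0 * coords F z 1 + coords F z 1 * coords F z 2 + coords F z 2 * coords F z 0 := by
  have h := hF.descartesForm_coords_self z
  simp only [descartesForm] at h
  linarith

theorem coords_sum_pos (hF : IsFrame F) (z : ℂ) :
    0 < coords F z 0 + coords F z 1 + coords F z 2 := by
  have h00 := hF.diag 0
  have h11 := hF.diag 1
  have h22 := hF.diag 2
  have h01 := hF.inversiveProd_row 0 1
  have h02 := hF.inversiveProd_row 0 2
  have h12 := hF.inversiveProd_row 1 2
  simp [gramMat] at h01 h02 h12
  have hsum : coords F z 0 + coords F z 1 + coords F z 2 = circleForm (F 0 + F 1 + F 2) z := by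
    simp [coords, circleForm]
    ring
  have hpos : 0 < (F 0 + F 1 + F 2) 0 := by
    have := hF.curv_add_pos
    have := hF.nonneg 2
    simp
    linarith
  have hprod : inversiveProd (F 0 + F 1 + F 2) (F 0 + F 1 + F 2) = -3 := by
    simp only [inversiveProd, Pi.add_apply] at h00 h11 h22 h01 h02 h12 ⊢
    linarith
  rw [hsum, circleForm_eq_of_pos hpos, hprod, neg_div, sub_neg_eq_add]
  positivity

end IsFrame

/-- The cone of null vectors corresponding to the open ideal triangle. -/
def openCone : Set (Fin 4 → ℝ) := {x | 0 < x 0 ∧ 0 < x 1 ∧ 0 < x 2 ∧ x 3 < 0}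

/-- The cone of null vectors corresponding to the closed ideal triangle. -/
def closedCone : Set (Fin 4 → ℝ) := {x | 0 ≤ x 0 ∧ 0 ≤ x 1 ∧ 0 ≤ x 2 ∧ x 3 ≤ 0}

/-- The null vector in `closedCone` with given first three coordinates. -/
noncomputable def liftVec (y : Fin 3 → ℝ) : Fin 4 → ℝ :=
  ![y 0, y 1, y 2, -Real.sqrt (y 0 * y 1 + y 1 * y 2 + y 2 * y 0)]

theorem continuous_liftVec : Continuous liftVec := by
  refine continuous_pi fun i => ?_
  fin_cases i <;> simp [liftVec] <;> fun_prop

theorem descartesForm_liftVec {y : Fin 3 → ℝ} (hy : ∀ i, 0 ≤ y i) :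
    descartesForm (liftVec y) (liftVec y) = 0 := by
  have h := Real.sq_sqrt (show 0 ≤ y 0 * y 1 + y 1 * y 2 + y 2 * y 0 from
    add_nonneg (add_nonneg (mul_nonneg (hy 0) (hy 1)) (mul_nonneg (hy 1) (hy 2)))
      (mul_nonneg (hy 2) (hy 0)))
  simp [descartesForm, liftVec]
  linarith

theorem liftVec_mem_openCone {y : Fin 3 → ℝ} (hy : ∀ i, 0 < y i) : liftVec y ∈ openCone := by
  refine ⟨hy 0, hy 1, hy 2, ?_⟩
  have h : 0 < y 0 * y 1 + y 1 * y 2 + y 2 * y 0 :=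
    add_pos (add_pos (mul_pos (hy 0) (hy 1)) (mul_pos (hy 1) (hy 2))) (mul_pos (hy 2) (hy 0))
  simpa [liftVec] using h

/-- A null vector in `closedCone` is determined by its first three coordinates. -/
theorem eq_liftVec {x : Fin 4 → ℝ} (hx : descartesForm x x = 0) (h3 : x 3 ≤ 0) :
    x = liftVec (fun i => x i.castSucc) := by
  have h : x 0 * x 1 + x 1 * x 2 + x 2 * x 0 = (-x 3) ^ 2 := by
    simp only [descartesForm] at hx
    linarith
  ext i
  fin_cases i <;> simp [liftVec]
  rw [h, Real.sqrt_sq (by linarith)]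
  ring

theorem smul_mem_openCone {x : Fin 4 → ℝ} {t : ℝ} (ht : 0 < t) (hx : x ∈ openCone) :
    t • x ∈ openCone :=
  ⟨mul_pos ht hx.1, mul_pos ht hx.2.1, mul_pos ht hx.2.2.1, mul_neg_of_pos_of_neg ht hx.2.2.2⟩

/-- The open ideal triangle of a frame. -/
def triangle (F : Matrix (Fin 4) (Fin 4) ℝ) : Set ℂ := {z | coords F z ∈ openCone}

/-- The triple of generalized disks `𝒟` is given by the first three rows of `F`. -/
def Represents (F : Matrix (Fin 4) (Fin 4) ℝ) (𝒟 : Fin 3 → Set ℂ) : Prop :=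
  ∀ j : Fin 3, 𝒟 j = {z | circleForm (F j.castSucc) z < 0}

namespace IsFrame

variable {F : Matrix (Fin 4) (Fin 4) ℝ}

theorem descartesForm_curv_pos (hF : IsFrame F) {x : Fin 4 → ℝ} (hx : x ∈ closedCone)
    (hne : 0 < x 0 + x 1 + x 2) : 0 < descartesForm x (Fᵀ 0) := by
  obtain ⟨h0, h1, h2, h3⟩ := hx
  obtain ⟨ha, hb, hc⟩ := hF.curv_add_pos
  have e3 : 0 ≤ -x 3 * F 3 0 := mul_nonneg (by linarith) hF.pos.le
  have e0 := mul_nonneg h0 hb.le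
  have e1 := mul_nonneg h1 hc.le
  have e2 := mul_nonneg h2 ha.le
  simp only [descartesForm, Matrix.transpose_apply]
  by_contra! hneg
  have z0 : x 0 * (F 1 0 + F 2 0) = 0 := by linarith
  have z1 : x 1 * (F 2 0 + F 0 0) = 0 := by linarith
  have z2 : x 2 * (F 0 0 + F 1 0) = 0 := by linarith
  have y0 := (mul_eq_zero.1 z0).resolve_right hb.ne'
  have y1 := (mul_eq_zero.1 z1).resolve_right hc.ne'
  have y2 := (mul_eq_zero.1 z2).resolve_right ha.ne'
  linarith

theorem continuousOn_pointOf (F : Matrix (Fin 4) (Fin 4) ℝ) :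
    ContinuousOn (pointOf F) {x | descartesForm x (Fᵀ 0) ≠ 0} := by
  have h : ∀ k, Continuous fun x : Fin 4 → ℝ => descartesForm x (Fᵀ k) := by
    intro k
    unfold descartesForm
    fun_prop
  have hd : ∀ k, ContinuousOn (fun x : Fin 4 → ℝ =>
      -descartesForm x (Fᵀ k) / descartesForm x (Fᵀ 0)) {x | descartesForm x (Fᵀ 0) ≠ 0} :=
    fun k => (h k).neg.continuousOn.div (h 0).continuousOn fun x hx => hx
  have hEq : pointOf F = fun x => (Complex.equivRealProdCLM.symm
      (-descartesForm x (Fᵀ 1) / descartesForm x (Fᵀ 0),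
        -descartesForm x (Fᵀ 2) / descartesForm x (Fᵀ 0))) := by
    ext x
    apply Complex.ext <;> simp [pointOf]
  rw [hEq]
  exact Complex.equivRealProdCLM.symm.continuous.comp_continuousOn ((hd 1).prodMk (hd 2))

theorem pointOf_liftVec_mem (hF : IsFrame F) {y : Fin 3 → ℝ} (hy : ∀ i, 0 < y i) :
    pointOf F (liftVec y) ∈ triangle F := by
  have hx := liftVec_mem_openCone hy
  have hpos := hF.descartesForm_curv_pos (x := liftVec y)
    ⟨hx.1.le, hx.2.1.le, hx.2.2.1.le, hx.2.2.2.le⟩ (add_pos (add_pos hx.1 hx.2.1) hx.2.2.1)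
  show coords F _ ∈ openCone
  rw [hF.coords_pointOf (descartesForm_liftVec fun i => (hy i).le) hpos.ne']
  exact smul_mem_openCone (by positivity) hx

theorem continuousAt_pointOf_liftVec (hF : IsFrame F) {y : Fin 3 → ℝ}
    (hy : ∀ i, 0 ≤ y i) (hne : 0 < y 0 + y 1 + y 2) :
    ContinuousAt (fun y => pointOf F (liftVec y)) y := by
  have hmem : liftVec y ∈ closedCone := ⟨hy 0, hy 1, hy 2, by simp [liftVec]⟩
  have hpos := hF.descartesForm_curv_pos hmem hne
  have hopen : IsOpen {x : Fin 4 → ℝ | descartesForm x (Fᵀ 0) ≠ 0} := by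
    refine isOpen_ne_fun ?_ continuous_const
    unfold descartesForm
    fun_prop
  have hc : ContinuousAt (pointOf F) (liftVec y) :=
    (continuousOn_pointOf F).continuousAt (hopen.mem_nhds hpos.ne')
  exact hc.comp_of_eq continuous_liftVec.continuousAt rfl

theorem triangle_eq_image (hF : IsFrame F) :
    triangle F = (fun y => pointOf F (liftVec y)) '' {y : Fin 3 → ℝ | ∀ i, 0 < y i} := by
  apply Set.Subset.antisymm
  · rintro z ⟨h0, h1, h2, h3⟩
    refine ⟨fun i => coords F z i.castSucc, ?_, ?_⟩
    · intro i
      fin_cases i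
      exacts [h0, h1, h2]
    · simp only
      rw [← eq_liftVec (hF.descartesForm_coords_self z) h3.le, hF.pointOf_coords]
  · rintro _ ⟨y, hy, rfl⟩
    exact hF.pointOf_liftVec_mem hy

theorem triangle_nonempty (hF : IsFrame F) : (triangle F).Nonempty :=
  ⟨_, hF.pointOf_liftVec_mem (y := fun _ => 1) fun _ => one_pos⟩

theorem isPreconnected_triangle (hF : IsFrame F) : IsPreconnected (triangle F) := by
  rw [hF.triangle_eq_image]
  refine IsPreconnected.image ?_ _ ?_
  · refine Convex.isPreconnected ?_
    intro a ha b hb s t hs ht hst i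
    have h1 := ha i
    have h2 := hb i
    simp only [Pi.add_apply, Pi.smul_apply, smul_eq_mul]
    rcases hs.eq_or_lt with h | h
    · have : t = 1 := by linarith
      simp [← h, this, h2]
    · exact add_pos_of_pos_of_nonneg (mul_pos h h1) (mul_nonneg ht h2.le)
  · intro y hy
    exact (hF.continuousAt_pointOf_liftVec (fun i => (hy i).le)
      (add_pos (add_pos (hy 0) (hy 1)) (hy 2))).continuousWithinAt

theorem closure_triangle (hF : IsFrame F) :
    closure (triangle F) = {z | coords F z ∈ closedCone} := by
  apply Set.Subset.antisymm
  · refine closure_minimal ?_ ?_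
    · rintro z ⟨h0, h1, h2, h3⟩
      exact ⟨h0.le, h1.le, h2.le, h3.le⟩
    · have hc := fun i => continuous_circleForm (F i)
      exact (isClosed_le continuous_const (hc 0)).inter
        ((isClosed_le continuous_const (hc 1)).inter
          ((isClosed_le continuous_const (hc 2)).inter (isClosed_le (hc 3) continuous_const)))
  · rintro z ⟨h0, h1, h2, h3⟩
    set y : Fin 3 → ℝ := fun i => coords F z i.castSucc with hydef
    have hy : ∀ i, 0 ≤ y i := by
      intro i
      fin_cases i
      exacts [h0, h1, h2]
    have hz : pointOf F (liftVec y) = z := by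
      rw [← eq_liftVec (hF.descartesForm_coords_self z) h3, hF.pointOf_coords]
    have hcont := hF.continuousAt_pointOf_liftVec hy (hF.coords_sum_pos z)
    have hpath : Tendsto (fun s : ℝ => fun i => y i + s) (𝓝[>] 0) (𝓝 y) := by
      have : Tendsto (fun s : ℝ => fun i => y i + s) (𝓝[>] 0) (𝓝 fun i => y i + 0) := by
        refine Tendsto.mono_left (Continuous.tendsto ?_ 0) nhdsWithin_le_nhds
        fun_prop
      simpa using this
    have htend := hcont.tendsto.comp hpath
    simp only [hz] at htend
    refine mem_closure_of_tendsto htend ?_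
    filter_upwards [self_mem_nhdsWithin] with s hs
    exact hF.pointOf_liftVec_mem fun i => add_pos_of_nonneg_of_pos (hy i) hs

theorem isBounded_triangle (hF : IsFrame F) : Bornology.IsBounded (triangle F) := by
  have hsub : triangle F ⊆ {z | circleForm (F 3) z < 0} := fun z hz => hz.2.2.2
  rw [circleForm_neg_eq_ball (hF.diag 3) hF.pos] at hsub
  exact Metric.isBounded_ball.subset hsub

theorem compl_iUnion_closure (hF : IsFrame F) {𝒟 : Fin 3 → Set ℂ} (h : Represents F 𝒟) :
    (⋃ j, closure (𝒟 j))ᶜ = {z | 0 < coords F z 0 ∧ 0 < coords F z 1 ∧ 0 < coords F z 2} := by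
  have hc : ∀ j, closure (𝒟 j) = {z | circleForm (F j.castSucc) z ≤ 0} := fun j => by
    rw [h j, closure_circleForm_neg (hF.diag _)]
  ext z
  simp [hc, Fin.forall_fin_succ, coords]

/-- The outer complementary region of a frame. -/
def outer (F : Matrix (Fin 4) (Fin 4) ℝ) : Set ℂ :=
  {z | 0 < coords F z 0 ∧ 0 < coords F z 1 ∧ 0 < coords F z 2 ∧ 0 < coords F z 3}

/-- The region outside of the three disks is radially unbounded away from the center of the
orthogonal circle. -/
theorem circleForm_ray (hF : IsFrame F) {i : Fin 4} (hi : i ≠ 3) {d : ℂ} {s : ℝ} (hs : 1 ≤ s)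
    (h3 : 0 < circleForm (F 3) (⟨-F 3 1 / F 3 0, -F 3 2 / F 3 0⟩ + d))
    (h : 0 < circleForm (F i) (⟨-F 3 1 / F 3 0, -F 3 2 / F 3 0⟩ + d)) :
    0 < circleForm (F i) (⟨-F 3 1 / F 3 0, -F 3 2 / F 3 0⟩ + s * d) := by
  have hpos := hF.pos
  have horth : inversiveProd (F i) (F 3) = 0 := by
    rw [hF.inversiveProd_row]
    fin_cases i <;> simp_all [gramMat]
  have hdiag := hF.diag 3
  have e3 : circleForm (F 3) (⟨-F 3 1 / F 3 0, -F 3 2 / F 3 0⟩ + d) =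
      F 3 0 * (d.re ^ 2 + d.im ^ 2) - 1 / F 3 0 := by
    rw [circleForm_eq_of_pos hpos, hdiag]
    simp only [Complex.add_re, Complex.add_im]
    ring
  have ei : ∀ t : ℝ, circleForm (F i) (⟨-F 3 1 / F 3 0, -F 3 2 / F 3 0⟩ + t * d) =
      F i 0 * (d.re ^ 2 + d.im ^ 2) * t ^ 2 + 2 * t * ((F i 0 * (-F 3 1 / F 3 0) + F i 1) * d.re +
        (F i 0 * (-F 3 2 / F 3 0) + F i 2) * d.im) + F i 0 / F 3 0 ^ 2 := by
    intro t
    rw [circleForm_add]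
    have : circleForm (F i) ⟨-F 3 1 / F 3 0, -F 3 2 / F 3 0⟩ = F i 0 / F 3 0 ^ 2 := by
      simp only [circleForm, inversiveProd] at horth hdiag ⊢
      field_simp
      linear_combination F i 0 * hdiag - 2 * F 3 0 * horth
    rw [this]
    ring
  have e1 := ei 1
  simp only [Complex.ofReal_one, one_mul] at e1
  rw [e1] at h
  rw [e3] at h3
  rw [ei s]
  have hi0 := hF.nonneg i
  have hd : 1 / F 3 0 ^ 2 < d.re ^ 2 + d.im ^ 2 := by
    rw [div_lt_iff₀ (by positivity)]
    have := mul_pos hpos h3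
    have h' : F 3 0 * (F 3 0 * (d.re ^ 2 + d.im ^ 2) - 1 / F 3 0) =
      (d.re ^ 2 + d.im ^ 2) * F 3 0 ^ 2 - 1 := by field_simp
    linarith
  have hq : F i 0 / F 3 0 ^ 2 = F i 0 * (1 / F 3 0 ^ 2) := by ring
  rw [hq] at h ⊢
  have hr : 0 < 1 / F 3 0 ^ 2 := by positivity
  generalize (F i 0 * (-F 3 1 / F 3 0) + F i 1) * d.re +
        (F i 0 * (-F 3 2 / F 3 0) + F i 2) * d.im = b at *
  generalize d.re ^ 2 + d.im ^ 2 = n at *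
  generalize 1 / F 3 0 ^ 2 = r at *
  have k1 : 0 ≤ F i 0 * (n - r) * (s - 1) :=
    mul_nonneg (mul_nonneg hi0 (by linarith)) (by linarith)
  have k2 : 0 ≤ F i 0 * (n - r) * (s * (s - 1)) :=
    mul_nonneg (mul_nonneg hi0 (by linarith)) (mul_nonneg (by linarith) (by linarith))
  have k3 : 0 < s * (F i 0 * n + 2 * b + F i 0 * r) := mul_pos (by linarith) (by linarith)
  have k4 : 0 ≤ F i 0 * r * (s - 1) ^ 2 := mul_nonneg (mul_nonneg hi0 hr.le) (sq_nonneg _)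
  nlinarith

theorem not_isBounded_component (hF : IsFrame F) {S : Set ℂ}
    (hS : outer F ⊆ S) {z : ℂ} (hz : z ∈ outer F) :
    ¬ Bornology.IsBounded (connectedComponentIn S z) := by
  set c : ℂ := ⟨-F 3 1 / F 3 0, -F 3 2 / F 3 0⟩ with hc
  set d : ℂ := z - c with hd
  have hzc : c + d = z := by simp [hd]
  obtain ⟨h0, h1, h2, h3⟩ := hz
  rw [← hzc] at h0 h1 h2 h3
  have e3 : ∀ s : ℝ, circleForm (F 3) (c + s * d) =
      F 3 0 * (d.re ^ 2 + d.im ^ 2) * s ^ 2 - 1 / F 3 0 := by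
    intro s
    rw [circleForm_eq_of_pos hF.pos, hF.diag]
    simp [hc]
    ring
  have h3' : 0 < F 3 0 * (d.re ^ 2 + d.im ^ 2) - 1 / F 3 0 := by
    have := e3 1
    simp only [Complex.ofReal_one, one_mul, one_pow, mul_one] at this
    rw [← this]
    exact h3
  have hpos := hF.pos
  have hinv : 0 < 1 / F 3 0 := by positivity
  have hdne : d ≠ 0 := by
    intro h
    rw [h] at h3'
    simp at h3'
    linarith
  have hray : (fun s : ℝ => c + s * d) '' Set.Ici 1 ⊆ outer F := by
    rintro _ ⟨s, hs, rfl⟩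
    have hs : 1 ≤ s := hs
    refine ⟨hF.circleForm_ray (by decide) hs h3 h0, hF.circleForm_ray (by decide) hs h3 h1,
      hF.circleForm_ray (by decide) hs h3 h2, ?_⟩
    show 0 < circleForm (F 3) _
    rw [e3]
    have : 0 ≤ F 3 0 * (d.re ^ 2 + d.im ^ 2) * (s ^ 2 - 1) :=
      mul_nonneg (by linarith) (by nlinarith)
    linarith
  have hconn : IsPreconnected ((fun s : ℝ => c + s * d) '' Set.Ici 1) :=
    (convex_Ici (1 : ℝ)).isPreconnected.image _ (by fun_prop)
  have hsub := hconn.subset_connectedComponentIn (x := z) ⟨1, Set.self_mem_Ici, by simp [hzc]⟩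
    (hray.trans hS)
  intro hb
  obtain ⟨R, hR⟩ := (hb.subset hsub).exists_norm_le
  have hn : 0 < ‖d‖ := norm_pos_iff.2 hdne
  set s : ℝ := 1 + (|R| + ‖c‖ + 1) / ‖d‖ with hs
  have hs1 : 1 ≤ s := by
    have : 0 ≤ (|R| + ‖c‖ + 1) / ‖d‖ := by positivity
    linarith
  have hle := hR (c + s * d) ⟨s, hs1, rfl⟩
  have h4 : ‖(s : ℂ) * d‖ = ‖d‖ + (|R| + ‖c‖ + 1) := by
    rw [norm_mul, Complex.norm_real, Real.norm_of_nonneg (by linarith), hs]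
    field_simp
  have h5 : ‖(s : ℂ) * d‖ ≤ ‖c + s * d‖ + ‖c‖ := by
    calc ‖(s : ℂ) * d‖ = ‖(c + s * d) - c‖ := by ring_nf
      _ ≤ _ := norm_sub_le _ _
  linarith [le_abs_self R]

theorem idealTriangle_eq (hF : IsFrame F) {𝒟 : Fin 3 → Set ℂ} (h : Represents F 𝒟) :
    idealTriangle 𝒟 = triangle F := by
  have hS := hF.compl_iUnion_closure h
  set S := (⋃ j, closure (𝒟 j))ᶜ with hSdef
  have hc := fun i => continuous_circleForm (F i)
  have htri : triangle F ⊆ S := by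
    rw [hS]
    exact fun z hz => ⟨hz.1, hz.2.1, hz.2.2.1⟩
  have hout : outer F ⊆ S := by
    rw [hS]
    exact fun z hz => ⟨hz.1, hz.2.1, hz.2.2.1⟩
  have hcover : ∀ z ∈ S, z ∈ triangle F ∨ z ∈ outer F := by
    intro z hz
    rw [hS] at hz
    obtain ⟨h0, h1, h2⟩ := hz
    have hne : coords F z 3 ≠ 0 := by
      intro h3
      have := hF.coords_sq z
      rw [h3] at this
      have := mul_pos h0 h1
      have := mul_pos h1 h2
      have := mul_pos h2 h0
      linarith
    rcases lt_or_gt_of_ne hne with h3 | h3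
    · exact Or.inl ⟨h0, h1, h2, h3⟩
    · exact Or.inr ⟨h0, h1, h2, h3⟩
  have hcomp : ∀ z ∈ triangle F, connectedComponentIn S z = triangle F := by
    intro z hz
    apply Set.Subset.antisymm
    · intro w hw
      have hpre : IsPreconnected (connectedComponentIn S z) := isPreconnected_connectedComponentIn
      have hsub : connectedComponentIn S z ⊆
          {z | circleForm (F 3) z < 0} ∪ {z | 0 < circleForm (F 3) z} := fun u hu =>
        (hcover u (connectedComponentIn_subset S z hu)).imp (fun k => k.2.2.2) (fun k => k.2.2.2)
      have hleft := hpre.subset_left_of_subset_union (isOpen_lt (hc 3) continuous_const)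
        (isOpen_lt continuous_const (hc 3))
        (Set.disjoint_left.2 fun u (hu : circleForm (F 3) u < 0)
          (hu' : 0 < circleForm (F 3) u) => lt_asymm hu hu')
        hsub ⟨z, mem_connectedComponentIn (htri hz), hz.2.2.2⟩
      rcases hcover w (connectedComponentIn_subset S z hw) with k | k
      · exact k
      · exact absurd k.2.2.2 (lt_asymm (hleft hw))
    · exact hF.isPreconnected_triangle.subset_connectedComponentIn hz htri
  obtain ⟨z₀, hz₀⟩ := hF.triangle_nonempty
  have hspec : Bornology.IsBounded (idealTriangle 𝒟) ∧
      ∃ z ∈ S, idealTriangle 𝒟 = connectedComponentIn S z :=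
    Classical.epsilon_spec (p := fun T : Set ℂ => Bornology.IsBounded T ∧
      ∃ z ∈ S, T = connectedComponentIn S z)
      ⟨triangle F, hF.isBounded_triangle, z₀, htri hz₀, (hcomp z₀ hz₀).symm⟩
  obtain ⟨hb, z, hz, hT⟩ := hspec
  rcases hcover z hz with k | k
  · rw [hT, hcomp z k]
  · rw [hT] at hb
    exact absurd hb (hF.not_isBounded_component hout k)

end IsFrame

theorem Mmat_gram (j : Fin 3) : (Mmat j)ᵀ * gramMat * Mmat j = gramMat := by
  fin_cases j <;> ext a b <;> fin_cases a <;> fin_cases b <;>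
    simp [Mmat, gramMat, Matrix.mul_apply, Fin.sum_univ_four] <;> norm_num

/-- The form of the inscribed disk of a frame. -/
def innerForm (F : Matrix (Fin 4) (Fin 4) ℝ) : Fin 4 → ℝ :=
  F 0 + F 1 + F 2 + (2 : ℝ) • F 3

theorem circleForm_innerForm (F : Matrix (Fin 4) (Fin 4) ℝ) (z : ℂ) :
    circleForm (innerForm F) z =
      coords F z 0 + coords F z 1 + coords F z 2 + 2 * coords F z 3 := by
  simp [circleForm, innerForm, coords]
  ring

theorem transpose_Mmat_mul_apply_self (F : Matrix (Fin 4) (Fin 4) ℝ) (j : Fin 3) :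
    ((Mmat j)ᵀ * F) j.castSucc = innerForm F := by
  ext k
  fin_cases j <;>
    simp [Mmat, innerForm, Matrix.mul_apply, Fin.sum_univ_four]

theorem transpose_Mmat_mul_apply_of_ne (F : Matrix (Fin 4) (Fin 4) ℝ) {i j : Fin 3}
    (h : i ≠ j) : ((Mmat j)ᵀ * F) i.castSucc = F i.castSucc := by
  ext k
  fin_cases j <;> fin_cases i <;>
    first
    | exact absurd rfl h
    | simp [Mmat, Matrix.mul_apply, Fin.sum_univ_four]

/-- The sign of the last coordinate of a null vector inside a disk tangent to three others. -/
theorem mem_openCone_of_null {x : Fin 4 → ℝ}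
    (hx : x 3 ^ 2 = x 0 * x 1 + x 1 * x 2 + x 2 * x 0) (hs : 0 < x 0 + x 1 + x 2)
    (hneg : x 0 + x 1 + x 2 + 2 * x 3 < 0) : x ∈ openCone := by
  have key : ∀ a b c t : ℝ, t ^ 2 = a * b + b * c + c * a → 0 < a + b + c →
      a + b + c + 2 * t < 0 → 0 < a := by
    intro a b c t h1 h2 h3
    have h4 : (a + b + c) ^ 2 < 4 * t ^ 2 := by nlinarith
    by_contra! ha
    nlinarith [sq_nonneg (b - c), mul_nonneg (neg_nonneg.2 ha) h2.le, sq_nonneg a]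
  exact ⟨key _ _ _ _ hx hs hneg, key (x 1) (x 2) (x 0) (x 3) (by linarith) (by linarith)
    (by linarith), key (x 2) (x 0) (x 1) (x 3) (by linarith) (by linarith) (by linarith),
    by linarith⟩

/-- The cone whose null vectors are the coordinates of the points of an Apollonian gasket. -/
def gasketCone : Set (Fin 4 → ℝ) :=
  {x | x ∈ closedCone ∧ ∀ w : Word, 0 ≤ (x ᵥ* Mword w) 0 + (x ᵥ* Mword w) 1 +
    (x ᵥ* Mword w) 2 + 2 * (x ᵥ* Mword w) 3}

namespace IsFrame

variable {F : Matrix (Fin 4) (Fin 4) ℝ}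

theorem step (hF : IsFrame F) (j : Fin 3) : IsFrame ((Mmat j)ᵀ * F) := by
  refine ⟨?_, ?_, ?_⟩
  · calc (Mmat j)ᵀ * F * formMat * ((Mmat j)ᵀ * F)ᵀ
        = (Mmat j)ᵀ * (F * formMat * Fᵀ) * Mmat j := by
          simp only [Matrix.transpose_mul, Matrix.transpose_transpose, Matrix.mul_assoc]
      _ = gramMat := by rw [hF.gram, Mmat_gram]
  · intro i
    have h0 := hF.nonneg 0
    have h1 := hF.nonneg 1
    have h2 := hF.nonneg 2
    have h3 := hF.nonneg 3
    fin_cases j <;> fin_cases i <;>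
      simp [Mmat, Matrix.mul_apply, Fin.sum_univ_four] <;> positivity
  · have h0 := hF.nonneg 0
    have h1 := hF.nonneg 1
    have h2 := hF.nonneg 2
    have h3 := hF.pos
    fin_cases j <;>
      simp [Mmat, Matrix.mul_apply, Fin.sum_univ_four] <;> positivity

theorem innerForm_unit (hF : IsFrame F) :
    inversiveProd (innerForm F) (innerForm F) = 1 := by
  have h := (hF.step 0).diag (Fin.castSucc 0)
  rwa [transpose_Mmat_mul_apply_self] at h

theorem innerForm_pos (hF : IsFrame F) : 0 < innerForm F 0 := by
  have h0 := hF.nonneg 0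
  have h1 := hF.nonneg 1
  have h2 := hF.nonneg 2
  have h3 := hF.pos
  simp [innerForm]
  positivity

theorem innerForm_tangent (hF : IsFrame F) (j : Fin 3) :
    inversiveProd (innerForm F) (F j.castSucc) = -1 := by
  have h0 := hF.inversiveProd_row 0 j.castSucc
  have h1 := hF.inversiveProd_row 1 j.castSucc
  have h2 := hF.inversiveProd_row 2 j.castSucc
  have h3 := hF.inversiveProd_row 3 j.castSucc
  have h : inversiveProd (innerForm F) (F j.castSucc) =
      gramMat 0 j.castSucc + gramMat 1 j.castSucc + gramMat 2 j.castSucc +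
        2 * gramMat 3 j.castSucc := by
    rw [← h0, ← h1, ← h2, ← h3]
    simp [inversiveProd, innerForm]
    ring
  rw [h]
  fin_cases j <;> simp [gramMat]

/-- A unit form tangent to the three disks of a frame is one of the two Descartes forms. -/
theorem tangent_form_eq (hF : IsFrame F) {v : Fin 4 → ℝ}
    (hv : inversiveProd v v = 1)
    (ht : ∀ j : Fin 3, inversiveProd v (F j.castSucc) = -1) :
    ∃ t : ℝ, (t = 2 ∨ t = -2) ∧ v = F 0 + F 1 + F 2 + t • F 3 := by
  have hdual := formMat_mul_of_gram hF.gram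
  set t := inversiveProd v (F 3) with htdef
  have hprod : ∀ i, (v ᵥ* formMat ᵥ* Fᵀ) i = inversiveProd v (F i) := by
    intro i
    simp [inversiveProd, formMat, Matrix.vecMul, dotProduct, Fin.sum_univ_four]
    ring
  have hvec : v ᵥ* formMat ᵥ* Fᵀ = ![-1, -1, -1, t] := by
    ext i
    rw [hprod]
    fin_cases i
    exacts [ht 0, ht 1, ht 2, rfl]
  have hv' : v = F 0 + F 1 + F 2 + t • F 3 := by
    have h : v = v ᵥ* formMat ᵥ* Fᵀ ᵥ* gramInv ᵥ* F := by
      conv_lhs => rw [← Matrix.vecMul_one v, ← hdual]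
      simp only [Matrix.vecMul_vecMul, Matrix.mul_assoc]
    rw [hvec] at h
    rw [h]
    ext k
    simp [gramInv, Matrix.vecMul, dotProduct, Fin.sum_univ_four]
    ring
  refine ⟨t, ?_, hv'⟩
  have hsq : t ^ 2 = 4 := by
    have e : inversiveProd v v = inversiveProd v (F 0) +
        inversiveProd v (F 1) + inversiveProd v (F 2) +
        t * inversiveProd v (F 3) := by
      conv_lhs => rw [show inversiveProd v v =
        inversiveProd v (F 0 + F 1 + F 2 + t • F 3) from congrArg _ hv']
      simp only [inversiveProd, Pi.add_apply, Pi.smul_apply, smul_eq_mul]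
      ring
    have e0 := ht 0
    have e1 := ht 1
    have e2 := ht 2
    simp only [Fin.castSucc_zero] at e0
    rw [hv, e0, show F 1 = F (Fin.castSucc 1) from rfl, e1,
      show F 2 = F (Fin.castSucc 2) from rfl, e2, ← htdef] at e
    linarith
  have : (t - 2) * (t + 2) = 0 := by linarith
  rcases mul_eq_zero.1 this with h | h
  · left; linarith
  · right; linarith

theorem Din_eq (hF : IsFrame F) {𝒟 : Fin 3 → Set ℂ} (h : Represents F 𝒟) :
    Din 𝒟 = {z | circleForm (innerForm F) z < 0} := by
  have hex : IsInscribedDisk 𝒟 {z | circleForm (innerForm F) z < 0} := by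
    refine ⟨isOpenDisk_of_pos hF.innerForm_unit hF.innerForm_pos, ?_, ?_⟩
    · rw [hF.idealTriangle_eq h]
      intro z (hz : circleForm (innerForm F) z < 0)
      rw [circleForm_innerForm] at hz
      exact mem_openCone_of_null (hF.coords_sq z) (hF.coords_sum_pos z) hz
    · intro j
      rw [h j]
      exact ⟨_, inter_eq_touchPoint hF.innerForm_unit (hF.diag _) (hF.innerForm_tangent j)
        (add_pos_of_pos_of_nonneg hF.innerForm_pos (hF.nonneg _))⟩
  obtain ⟨⟨c, r, hr, hball⟩, hsub, htan⟩ : IsInscribedDisk 𝒟 (Din 𝒟) :=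
    Classical.epsilon_spec ⟨_, hex⟩
  obtain ⟨v, -, hv, hDv⟩ := ball_eq_circleForm_neg c hr
  rw [← hball] at hDv
  have ht : ∀ j : Fin 3, inversiveProd v (F j.castSucc) = -1 := by
    intro j
    have := htan j
    rw [h j, hDv] at this
    exact inversiveProd_eq_neg_one hv (hF.diag _) this
  obtain ⟨t, rfl | rfl, hvt⟩ := hF.tangent_form_eq hv ht
  · rw [hDv, hvt, innerForm]
  · exfalso
    have hc : c ∈ Din 𝒟 := by
      rw [hball]
      exact Metric.mem_ball_self hr
    have hctri := hsub hc
    rw [hF.idealTriangle_eq h] at hctri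
    rw [hDv] at hc
    have hcneg : circleForm v c < 0 := hc
    have hval : circleForm v c =
        coords F c 0 + coords F c 1 + coords F c 2 - 2 * coords F c 3 := by
      rw [hvt]
      simp [circleForm, coords]
      ring
    have h3 := hctri.2.2.2
    have hs := hF.coords_sum_pos c
    linarith

theorem represents_Phi (hF : IsFrame F) {𝒟 : Fin 3 → Set ℂ} (h : Represents F 𝒟) (j : Fin 3) :
    Represents ((Mmat j)ᵀ * F) (Phi j 𝒟) := by
  intro i
  by_cases hij : i = j
  · subst hij
    rw [Phi, Function.update_self, transpose_Mmat_mul_apply_self, hF.Din_eq h]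
  · rw [Phi, Function.update_of_ne hij, transpose_Mmat_mul_apply_of_ne F hij, h i]

theorem applyWord (hF : IsFrame F) {𝒟 : Fin 3 → Set ℂ} (h : Represents F 𝒟) (w : Word) :
    IsFrame ((Mword w)ᵀ * F) ∧ Represents ((Mword w)ᵀ * F) (applyWord 𝒟 w) := by
  induction w generalizing F 𝒟 with
  | nil => simpa [Mword, _root_.applyWord] using And.intro hF h
  | cons j w ih =>
    have := ih (hF.step j) (hF.represents_Phi h j)
    simpa [Mword, _root_.applyWord, Matrix.transpose_mul, Matrix.mul_assoc] using this

theorem AG_eq (hF : IsFrame F) {𝒟 : Fin 3 → Set ℂ} (h : Represents F 𝒟) :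
    AG 𝒟 = {z | coords F z ∈ gasketCone} := by
  ext z
  have hD : ∀ w, z ∈ Din (_root_.applyWord 𝒟 w) ↔ (coords F z ᵥ* Mword w) 0 +
      (coords F z ᵥ* Mword w) 1 + (coords F z ᵥ* Mword w) 2 +
      2 * (coords F z ᵥ* Mword w) 3 < 0 := by
    intro w
    obtain ⟨h1, h2⟩ := hF.applyWord h w
    rw [h1.Din_eq h2, ← coords_transpose_mul, ← circleForm_innerForm]
    rfl
  simp only [AG, hF.idealTriangle_eq h, hF.closure_triangle, Set.mem_sdiff, Set.mem_iUnion, hD,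
    not_exists, not_lt]
  rfl

end IsFrame

/-- The matrix with rows three given circle forms and `s` times their common orthogonal form. -/
noncomputable def orthFrame (u v w : Fin 4 → ℝ) (s : ℝ) : Matrix (Fin 4) (Fin 4) ℝ :=
  ![u, v, w,
    ![-s / 2 * (u 0 * (v 1 * w 2 - v 2 * w 1) - u 1 * (v 0 * w 2 - v 2 * w 0) +
          u 2 * (v 0 * w 1 - v 1 * w 0)),
      s / 4 * (u 0 * (v 2 * w 3 - v 3 * w 2) - u 2 * (v 0 * w 3 - v 3 * w 0) +
          u 3 * (v 0 * w 2 - v 2 * w 0)),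
      -s / 4 * (u 0 * (v 1 * w 3 - v 3 * w 1) - u 1 * (v 0 * w 3 - v 3 * w 0) +
          u 3 * (v 0 * w 1 - v 1 * w 0)),
      s / 2 * (u 1 * (v 2 * w 3 - v 3 * w 2) - u 2 * (v 1 * w 3 - v 3 * w 1) +
          u 3 * (v 1 * w 2 - v 2 * w 1))]]

theorem inversiveProd_comm (v w : Fin 4 → ℝ) : inversiveProd v w = inversiveProd w v := by
  unfold inversiveProd
  ring

theorem orthFrame_gram {u v w : Fin 4 → ℝ} {s : ℝ} (hs : s ^ 2 = 1)
    (huu : inversiveProd u u = 1) (hvv : inversiveProd v v = 1) (hww : inversiveProd w w = 1)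
    (huv : inversiveProd u v = -1) (huw : inversiveProd u w = -1)
    (hvw : inversiveProd v w = -1) :
    orthFrame u v w s * formMat * (orthFrame u v w s)ᵀ = gramMat := by
  have h3u : inversiveProd u (orthFrame u v w s 3) = 0 := by
    simp [inversiveProd, orthFrame]
    ring
  have h3v : inversiveProd v (orthFrame u v w s 3) = 0 := by
    simp [inversiveProd, orthFrame]
    ring
  have h3w : inversiveProd w (orthFrame u v w s 3) = 0 := by
    simp [inversiveProd, orthFrame]
    ring
  have h33 : inversiveProd (orthFrame u v w s 3) (orthFrame u v w s 3) = 1 := by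
    have h : inversiveProd (orthFrame u v w s 3) (orthFrame u v w s 3) = -(s ^ 2 / 4) *
        (inversiveProd u u * (inversiveProd v v * inversiveProd w w - inversiveProd v w ^ 2) -
          inversiveProd u v * (inversiveProd u v * inversiveProd w w -
            inversiveProd v w * inversiveProd u w) +
          inversiveProd u w * (inversiveProd u v * inversiveProd v w -
            inversiveProd v v * inversiveProd u w)) := by
      simp [inversiveProd, orthFrame]
      ring
    rw [h, huu, hvv, hww, huv, huw, hvw, hs]
    norm_num
  ext i j
  rw [← inversiveProd_eq]
  fin_cases i <;> fin_cases j
  exacts [huu, huv, huw, h3u, inversiveProd_comm u v ▸ huv, hvv, hvw, h3v,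
    inversiveProd_comm u w ▸ huw, inversiveProd_comm v w ▸ hvw, hww, h3w,
    inversiveProd_comm u _ ▸ h3u, inversiveProd_comm v _ ▸ h3v, inversiveProd_comm w _ ▸ h3w,
    h33]

theorem IsFrame.of_gram_of_neg {u v w : Fin 4 → ℝ} (hu : 0 ≤ u 0) (hv : 0 ≤ v 0) (hw : 0 ≤ w 0)
    (hpos : 0 < u 0 * v 0 + v 0 * w 0 + w 0 * u 0)
    (huu : inversiveProd u u = 1) (hvv : inversiveProd v v = 1)
    (hww : inversiveProd w w = 1) (huv : inversiveProd u v = -1)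
    (huw : inversiveProd u w = -1) (hvw : inversiveProd v w = -1) :
    ∃ s, IsFrame (orthFrame u v w s) := by
  have hg1 := orthFrame_gram (s := 1) (by norm_num) huu hvv hww huv huw hvw
  have hg2 := orthFrame_gram (s := -1) (by norm_num) huu hvv hww huv huw hvw
  have hsq : orthFrame u v w 1 3 0 ^ 2 = u 0 * v 0 + v 0 * w 0 + w 0 * u 0 :=
    curv_sq_of_gram hg1
  have hneg : orthFrame u v w (-1) 3 0 = -orthFrame u v w 1 3 0 := by
    simp [orthFrame]
    ring
  have hne : orthFrame u v w 1 3 0 ≠ 0 := by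
    intro h
    rw [h] at hsq
    linarith
  rcases lt_or_gt_of_ne hne with h | h
  · refine ⟨-1, hg2, ?_, by linarith⟩
    intro i
    fin_cases i
    exacts [hu, hv, hw, by simpa [hneg] using h.le]
  · refine ⟨1, hg1, ?_, h⟩
    intro i
    fin_cases i
    exacts [hu, hv, hw, h.le]

/-- Every tangential disk triple is given by a frame. -/
theorem exists_isFrame_of_isTDT {𝒟 : Fin 3 → Set ℂ} (h : IsTDT 𝒟) :
    ∃ F, IsFrame F ∧ Represents F 𝒟 := by
  obtain ⟨hdisk, htan⟩ := h
  have hD : ∀ j, IsOpenDisk (𝒟 j) →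
      ∃ v : Fin 4 → ℝ, 0 < v 0 ∧ inversiveProd v v = 1 ∧ 𝒟 j = {z | circleForm v z < 0} := by
    rintro j ⟨c, r, hr, hball⟩
    obtain ⟨v, h0, hv, hDv⟩ := ball_eq_circleForm_neg c hr
    exact ⟨v, h0 ▸ inv_pos.2 hr, hv, hball.trans hDv⟩
  have hform : ∃ v : Fin 3 → Fin 4 → ℝ, (∀ j, 0 ≤ v j 0) ∧ (∃ j, ∀ k, k ≠ j → 0 < v k 0) ∧
      (∀ j, inversiveProd (v j) (v j) = 1) ∧ ∀ j, 𝒟 j = {z | circleForm (v j) z < 0} := by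
    rcases hdisk with hall | ⟨j, hj, hk⟩
    · choose v h1 h2 h3 using fun j => hD j (hall j)
      exact ⟨v, fun j => (h1 j).le, ⟨0, fun k _ => h1 k⟩, h2, h3⟩
    · have hv : ∀ k, ∃ v : Fin 4 → ℝ, 0 ≤ v 0 ∧ (k ≠ j → 0 < v 0) ∧ inversiveProd v v = 1 ∧
          𝒟 k = {z | circleForm v z < 0} := by
        intro k
        by_cases hkj : k = j
        · obtain ⟨v, h0, h1, h2⟩ := halfPlane_eq_circleForm_neg hj
          exact ⟨v, h0.ge, fun h => absurd hkj h, h1, hkj ▸ h2⟩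
        · obtain ⟨v, h0, h1, h2⟩ := hD k (hk k hkj)
          exact ⟨v, h0.le, fun _ => h0, h1, h2⟩
      choose v h1 h2 h3 h4 using hv
      exact ⟨v, h1, ⟨j, h2⟩, h3, h4⟩
  obtain ⟨v, hnn, ⟨j, hpos⟩, hunit, hrep⟩ := hform
  have hneg : ∀ i k, i ≠ k → inversiveProd (v i) (v k) = -1 := by
    intro i k hik
    have := htan i k hik
    rw [hrep i, hrep k] at this
    exact inversiveProd_eq_neg_one (hunit i) (hunit k) this
  have hsum : 0 < v 0 0 * v 1 0 + v 1 0 * v 2 0 + v 2 0 * v 0 0 := by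
    have h01 := mul_nonneg (hnn 0) (hnn 1)
    have h12 := mul_nonneg (hnn 1) (hnn 2)
    have h20 := mul_nonneg (hnn 2) (hnn 0)
    fin_cases j
    · have := mul_pos (hpos 1 (by decide)) (hpos 2 (by decide))
      linarith
    · have := mul_pos (hpos 2 (by decide)) (hpos 0 (by decide))
      linarith
    · have := mul_pos (hpos 0 (by decide)) (hpos 1 (by decide))
      linarith
  obtain ⟨s, hs⟩ := IsFrame.of_gram_of_neg (hnn 0) (hnn 1) (hnn 2) hsum (hunit 0) (hunit 1)
    (hunit 2) (hneg 0 1 (by decide)) (hneg 0 2 (by decide)) (hneg 1 2 (by decide))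
  refine ⟨_, hs, fun i => ?_⟩
  rw [hrep i]
  fin_cases i <;> rfl

/-- The triple of generalized disks given by a frame. -/
def diskTriple (F : Matrix (Fin 4) (Fin 4) ℝ) : Fin 3 → Set ℂ :=
  fun j => {z | circleForm (F j.castSucc) z < 0}

namespace IsFrame

variable {F : Matrix (Fin 4) (Fin 4) ℝ}

theorem curv_add_pos_of_ne (hF : IsFrame F) {i j : Fin 3} (h : i ≠ j) :
    0 < F i.castSucc 0 + F j.castSucc 0 := by
  obtain ⟨ha, hb, hc⟩ := hF.curv_add_pos
  fin_cases i <;> fin_cases j <;> first | exact absurd rfl h | skip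
  exacts [ha, (add_comm _ _).trans_gt hc, (add_comm _ _).trans_gt ha, hb, hc,
    (add_comm _ _).trans_gt hb]

theorem inter_closure_diskTriple (hF : IsFrame F) {i j : Fin 3} (h : i ≠ j) :
    closure (diskTriple F i) ∩ closure (diskTriple F j) =
      {touchPoint (F i.castSucc) (F j.castSucc)} := by
  refine inter_eq_touchPoint (hF.diag _) (hF.diag _) ?_ (hF.curv_add_pos_of_ne h)
  rw [hF.inversiveProd_row]
  fin_cases i <;> fin_cases j <;> first | exact absurd rfl h | simp [gramMat]

theorem isTDT_diskTriple (hF : IsFrame F) : IsTDT (diskTriple F) := by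
  refine ⟨?_, fun j k hjk => ⟨_, hF.inter_closure_diskTriple hjk⟩⟩
  by_cases h : ∀ j : Fin 3, 0 < F j.castSucc 0
  · exact Or.inl fun j => isOpenDisk_of_pos (hF.diag _) (h j)
  · push Not at h
    obtain ⟨j, hj⟩ := h
    have hj0 : F j.castSucc 0 = 0 := le_antisymm hj (hF.nonneg _)
    refine Or.inr ⟨j, isOpenHalfPlane_of_zero (hF.diag _) hj0, fun k hk => ?_⟩
    refine isOpenDisk_of_pos (hF.diag _) ?_
    have := hF.curv_add_pos_of_ne hk
    rwa [hj0, add_zero] at this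

theorem tangencyPoint_diskTriple (hF : IsFrame F) (j : Fin 3) :
    tangencyPoint (diskTriple F) j = touchPoint (F (j + 1).castSucc) (F (j + 2).castSucc) := by
  have hne : j + 1 ≠ j + 2 := by
    fin_cases j <;> decide
  have hEq := hF.inter_closure_diskTriple hne
  have hspec : closure (diskTriple F (j + 1)) ∩ closure (diskTriple F (j + 2)) =
      {tangencyPoint (diskTriple F) j} :=
    Classical.epsilon_spec (p := fun p : ℂ => closure (diskTriple F (j + 1)) ∩
      closure (diskTriple F (j + 2)) = {p}) ⟨_, hEq⟩
  rw [hEq] at hspec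
  exact (Set.singleton_injective hspec).symm

theorem curv_diskTriple (hF : IsFrame F) (j : Fin 3) :
    curv (diskTriple F j) = F j.castSucc 0 :=
  curv_circleForm (hF.diag _) (hF.nonneg _)

end IsFrame

/-- A frame with prescribed curvatures `(g 0, g 1, g 2, g 3)`. -/
noncomputable def modelFrame (g : Fin 4 → ℝ) : Matrix (Fin 4) (Fin 4) ℝ :=
  !![g 0, 1, 0, 0; g 1, -1, 0, 0;
    g 2, (g 0 - g 1) / (g 0 + g 1), -2 * g 3 / (g 0 + g 1), 4 / (g 0 + g 1);
    g 3, 0, -1, 0]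

/-- Membership in `Gamma`, without square roots. -/
theorem mem_Gamma_iff {g : Fin 4 → ℝ} : g ∈ Gamma ↔ 0 ≤ g 0 ∧ 0 ≤ g 1 ∧ 0 ≤ g 2 ∧
    g 3 ^ 2 = g 0 * g 1 + g 1 * g 2 + g 2 * g 0 ∧ 0 < g 3 := by
  simp only [Gamma, kappa, Set.mem_ofPred_eq]
  constructor
  · rintro ⟨h0, h1, h2, h3, h4⟩
    refine ⟨h0, h1, h2, ?_, h4⟩
    rw [h3, Real.sq_sqrt (add_nonneg (add_nonneg (mul_nonneg h1 h2) (mul_nonneg h2 h0))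
      (mul_nonneg h0 h1))]
    ring
  · rintro ⟨h0, h1, h2, h3, h4⟩
    refine ⟨h0, h1, h2, ?_, h4⟩
    rw [show g 1 * g 2 + g 2 * g 0 + g 0 * g 1 = g 3 ^ 2 by rw [h3]; ring, Real.sqrt_sq h4.le]

theorem add_pos_of_mem_Gamma {g : Fin 4 → ℝ} (hg : g ∈ Gamma) :
    0 < g 0 + g 1 ∧ 0 < g 1 + g 2 ∧ 0 < g 2 + g 0 := by
  obtain ⟨h0, h1, h2, h3, h4⟩ := mem_Gamma_iff.1 hg
  have h5 := pow_pos h4 2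
  refine ⟨?_, ?_, ?_⟩ <;> by_contra! hneg
  · have e0 : g 0 = 0 := by linarith
    have e1 : g 1 = 0 := by linarith
    rw [e0, e1] at h3; linarith
  · have e0 : g 1 = 0 := by linarith
    have e1 : g 2 = 0 := by linarith
    rw [e0, e1] at h3; linarith
  · have e0 : g 2 = 0 := by linarith
    have e1 : g 0 = 0 := by linarith
    rw [e0, e1] at h3; linarith

theorem isFrame_modelFrame {g : Fin 4 → ℝ} (hg : g ∈ Gamma) : IsFrame (modelFrame g) := by
  have hsum := (add_pos_of_mem_Gamma hg).1
  obtain ⟨h0, h1, h2, h3, h4⟩ := mem_Gamma_iff.1 hg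
  refine ⟨?_, ?_, h4⟩
  · ext i j
    rw [← inversiveProd_eq]
    fin_cases i <;> fin_cases j <;> simp [inversiveProd, modelFrame, gramMat] <;> field_simp <;>
      first
      | ring1
      | linear_combination 8 * h3
  · intro i
    fin_cases i
    exacts [h0, h1, h2, h4.le]

theorem exists_isTDTplus {g : Fin 4 → ℝ} (hg : g ∈ Gamma) :
    ∃ 𝒟, IsTDTplus 𝒟 ∧ curv (𝒟 0) = g 0 ∧ curv (𝒟 1) = g 1 ∧ curv (𝒟 2) = g 2 := by
  have hF := isFrame_modelFrame hg
  refine ⟨diskTriple (modelFrame g), ⟨hF.isTDT_diskTriple, ?_⟩, hF.curv_diskTriple 0,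
    hF.curv_diskTriple 1, hF.curv_diskTriple 2⟩
  obtain ⟨ha, hb, hc⟩ := add_pos_of_mem_Gamma hg
  have hκ := hg.2.2.2.2
  have e0 := hF.tangencyPoint_diskTriple 0
  have e1 := hF.tangencyPoint_diskTriple 1
  have e2 := hF.tangencyPoint_diskTriple 2
  have t0 : tangencyPoint (diskTriple (modelFrame g)) 0 =
    touchPoint (modelFrame g 1) (modelFrame g 2) := e0
  have t1 : tangencyPoint (diskTriple (modelFrame g)) 1 =
    touchPoint (modelFrame g 2) (modelFrame g 0) := e1
  have t2 : tangencyPoint (diskTriple (modelFrame g)) 2 =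
    touchPoint (modelFrame g 0) (modelFrame g 1) := e2
  rw [t0, t1, t2]
  have hval : ∀ p q r : ℂ, (q - p).re * (r - p).im - (q - p).im * (r - p).re =
      p.re * q.im - p.im * q.re + (q.re * r.im - q.im * r.re) +
        (r.re * p.im - r.im * p.re) := by
    intro p q r
    simp
    ring
  have hpos : 0 < 4 * g 3 / ((g 0 + g 1) * (g 1 + g 2) * (g 2 + g 0)) := by positivity
  have hb' : g 2 + g 1 ≠ 0 := by linarith
  have ha' : g 1 + g 0 ≠ 0 := by linarith
  have hc' : g 0 + g 2 ≠ 0 := by linarith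
  rw [hval]
  convert hpos using 1
  simp [touchPoint, modelFrame]
  field_simp
  ring

theorem vecMul_Mmat_mem_Gamma {g : Fin 4 → ℝ} (hg : g ∈ Gamma) (j : Fin 3) :
    g ᵥ* Mmat j ∈ Gamma := by
  rw [mem_Gamma_iff] at hg ⊢
  obtain ⟨h0, h1, h2, h3, h4⟩ := hg
  fin_cases j <;>
    simp only [Mmat, Matrix.vecMul, dotProduct, Fin.sum_univ_four] <;> simp <;>
    refine ⟨?_, ?_, ?_, ?_, ?_⟩ <;> first | positivity | linear_combination h3

theorem vecMul_Mword_mem_Gamma {g : Fin 4 → ℝ} (hg : g ∈ Gamma) (w : Word) :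
    g ᵥ* Mword w ∈ Gamma := by
  induction w generalizing g with
  | nil => simpa [Mword] using hg
  | cons j w ih =>
    have h := ih (vecMul_Mmat_mem_Gamma hg j)
    rwa [Matrix.vecMul_vecMul] at h

theorem GammaEps_subset_Gamma {ε : ℝ} (hε : 0 < ε) : GammaEps ε ⊆ Gamma := by
  rintro g ⟨⟨h0, -⟩, ⟨h1, -⟩, ⟨h2, -⟩, h3, h4, h5, h6⟩
  refine ⟨h0, h1, h2, h3, ?_⟩
  rw [h3, kappa]
  refine Real.sqrt_pos.2 ?_
  have e0 := mul_nonneg h1 h2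
  have e1 := mul_nonneg h2 h0
  have e2 := mul_nonneg h0 h1
  by_contra! hneg
  nlinarith [mul_nonneg h0 h0, mul_pos hε hε]

theorem exists_isFrame_tripleOf {g : Fin 4 → ℝ} (hg : g ∈ Gamma) :
    ∃ F, IsFrame F ∧ Represents F (tripleOf g) ∧ Fᵀ 0 = g := by
  obtain ⟨hT, hc0, hc1, hc2⟩ : IsTDTplus (tripleOf g) ∧ curv (tripleOf g 0) = g 0 ∧
      curv (tripleOf g 1) = g 1 ∧ curv (tripleOf g 2) = g 2 :=
    Classical.epsilon_spec (exists_isTDTplus hg)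
  obtain ⟨F, hF, hR⟩ := exists_isFrame_of_isTDT hT.1
  have hcurv : ∀ j : Fin 3, curv (tripleOf g j) = F j.castSucc 0 := fun j => by
    rw [hR j, curv_circleForm (hF.diag _) (hF.nonneg _)]
  have e0 : F 0 0 = g 0 := (hcurv 0).symm.trans hc0
  have e1 : F 1 0 = g 1 := (hcurv 1).symm.trans hc1
  have e2 : F 2 0 = g 2 := (hcurv 2).symm.trans hc2
  have hsq := hF.curv_sq
  rw [e0, e1, e2] at hsq
  obtain ⟨-, -, -, h3, h4⟩ := mem_Gamma_iff.1 hg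
  have e3 : F 3 0 = g 3 := (sq_eq_sq₀ hF.pos.le h4.le).1 (hsq.trans h3.symm)
  refine ⟨F, hF, hR, ?_⟩
  ext i
  fin_cases i
  exacts [e0, e1, e2, e3]

/-- The convex cone spanned by the null vectors of `closedCone`. -/
def hullCone : Set (Fin 4 → ℝ) := {x | x ∈ closedCone ∧ -x 3 ≤ x 0 + x 1 + x 2}

theorem mem_hullCone {x : Fin 4 → ℝ} (hx : x ∈ closedCone) (h : descartesForm x x = 0) :
    x ∈ hullCone := by
  refine ⟨hx, ?_⟩
  obtain ⟨h0, h1, h2, h3⟩ := hx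
  simp only [descartesForm] at h
  have e0 := mul_nonneg h0 h1
  have e1 := mul_nonneg h1 h2
  have e2 := mul_nonneg h2 h0
  refine abs_le_of_sq_le_sq' ?_ (by positivity) |>.2
  nlinarith

/-- The adjoint of `Mmat j` with respect to `descartesForm` preserves `hullCone`. -/
theorem exists_descartesForm_vecMul_Mmat (j : Fin 3) {x : Fin 4 → ℝ} (hx : x ∈ hullCone) :
    ∃ y ∈ hullCone, ∀ g, descartesForm x (g ᵥ* Mmat j) = descartesForm y g := by
  obtain ⟨⟨h0, h1, h2, h3⟩, -⟩ := hx
  have hcone : ∀ a b c d : ℝ, 0 ≤ a → 0 ≤ b → 0 ≤ c → d ≤ 0 → -d ≤ a + b + c →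
      ![a, b, c, d] ∈ hullCone := fun _ _ _ _ ha hb hc hd h => ⟨⟨ha, hb, hc, hd⟩, h⟩
  fin_cases j
  · refine ⟨![x 0 + x 1 + x 2 - 2 * x 3, x 1, x 2, x 3 - x 1 - x 2],
      hcone _ _ _ _ (by linarith) h1 h2 (by linarith) (by linarith), fun g => ?_⟩
    simp [Mmat, Matrix.vecMul, dotProduct, Fin.sum_univ_four, descartesForm]
    ring
  · refine ⟨![x 0, x 0 + x 1 + x 2 - 2 * x 3, x 2, x 3 - x 0 - x 2],
      hcone _ _ _ _ h0 (by linarith) h2 (by linarith) (by linarith), fun g => ?_⟩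
    simp [Mmat, Matrix.vecMul, dotProduct, Fin.sum_univ_four, descartesForm]
    ring
  · refine ⟨![x 0, x 1, x 0 + x 1 + x 2 - 2 * x 3, x 3 - x 0 - x 1],
      hcone _ _ _ _ h0 h1 (by linarith) (by linarith) (by linarith), fun g => ?_⟩
    simp [Mmat, Matrix.vecMul, dotProduct, Fin.sum_univ_four, descartesForm]
    ring

theorem exists_descartesForm_vecMul_Mword (w : Word) {x : Fin 4 → ℝ} (hx : x ∈ hullCone) :
    ∃ y ∈ hullCone, ∀ g, descartesForm x (g ᵥ* Mword w) = descartesForm y g := by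
  induction w with
  | nil => exact ⟨x, hx, fun g => by simp [Mword]⟩
  | cons j w ih =>
    obtain ⟨y, hy, hxy⟩ := ih
    obtain ⟨u, hu, hyu⟩ := exists_descartesForm_vecMul_Mmat j hy
    refine ⟨u, hu, fun g => ?_⟩
    rw [← hyu, ← hxy, Matrix.vecMul_vecMul]
    rfl

theorem descartesForm_le_of_mem_GammaEps {ε : ℝ} (hε : 0 < ε) {g g' : Fin 4 → ℝ}
    (hg : g ∈ GammaEps ε) (hg' : g' ∈ GammaEps ε) {x : Fin 4 → ℝ} (hx : x ∈ hullCone) :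
    descartesForm x g ≤ 6 * ε⁻¹ ^ 2 * descartesForm x g' := by
  obtain ⟨⟨x0, x1, x2, x3⟩, hx3⟩ := hx
  have hlower : ε * (x 0 + x 1 + x 2) ≤ descartesForm x g' := by
    have hpos := (GammaEps_subset_Gamma hε hg').2.2.2.2
    obtain ⟨-, -, -, -, h4, h5, h6⟩ := hg'
    simp only [descartesForm]
    nlinarith [mul_nonneg (neg_nonneg.2 x3) hpos.le]
  have hupper : descartesForm x g ≤ 6 * ε⁻¹ * (x 0 + x 1 + x 2) := by
    obtain ⟨-, -, -, hsq, hpos⟩ := mem_Gamma_iff.1 (GammaEps_subset_Gamma hε hg)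
    obtain ⟨⟨h0, h0'⟩, ⟨h1, h1'⟩, ⟨h2, h2'⟩, -⟩ := hg
    have hinv := inv_pos.2 hε
    have hg3 : g 3 ≤ 2 * ε⁻¹ := by
      refine abs_le_of_sq_le_sq' ?_ (by positivity) |>.2
      nlinarith [mul_le_mul h0' h1' h1 hinv.le, mul_le_mul h1' h2' h2 hinv.le,
        mul_le_mul h2' h0' h0 hinv.le]
    have e := mul_le_mul hx3 hg3 hpos.le (by positivity)
    simp only [descartesForm]
    nlinarith [mul_le_mul_of_nonneg_left (add_le_add h1' h2') x0,
      mul_le_mul_of_nonneg_left (add_le_add h0' h2') x1,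
      mul_le_mul_of_nonneg_left (add_le_add h0' h1') x2]
  calc descartesForm x g ≤ 6 * ε⁻¹ * (x 0 + x 1 + x 2) := hupper
    _ = 6 * ε⁻¹ ^ 2 * (ε * (x 0 + x 1 + x 2)) := by field_simp
    _ ≤ _ := mul_le_mul_of_nonneg_left hlower (by positivity)

theorem smul_mem_gasketCone {x : Fin 4 → ℝ} {t : ℝ} (ht : 0 ≤ t) (hx : x ∈ gasketCone) :
    t • x ∈ gasketCone := by
  obtain ⟨⟨h0, h1, h2, h3⟩, hw⟩ := hx
  refine ⟨⟨mul_nonneg ht h0, mul_nonneg ht h1, mul_nonneg ht h2,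
    mul_nonpos_of_nonneg_of_nonpos ht h3⟩, fun w => ?_⟩
  have h := mul_nonneg ht (hw w)
  simp only [Matrix.smul_vecMul, Pi.smul_apply, smul_eq_mul]
  linarith

section Comparison

variable {F F' : Matrix (Fin 4) (Fin 4) ℝ} {𝒟 𝒟' : Fin 3 → Set ℂ} {K : ℝ≥0}

theorem dist_sq_eq_descartesForm (hF : IsFrame F) (z w : ℂ) :
    4 * dist z w ^ 2 = descartesForm (coords F z) (coords F w) := by
  rw [hF.descartesForm_coords, Complex.dist_eq, Complex.sq_norm, Complex.normSq_apply]
  simp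
  ring

/-- Transporting the coordinates of one frame to another is Lipschitz with constant given by
the comparison of the curvature vectors. -/
theorem lipschitzOnWith_pointOf_coords (hF : IsFrame F) (hF' : IsFrame F')
    (hK : ∀ x ∈ hullCone, descartesForm x (Fᵀ 0) ≤ K * descartesForm x (F'ᵀ 0)) :
    LipschitzOnWith K (fun z => pointOf F' (coords F z)) {z | coords F z ∈ closedCone} := by
  refine LipschitzOnWith.of_dist_le_mul fun z hz w hw => ?_
  have hlow : ∀ u, coords F u ∈ closedCone → 4 ≤ K * descartesForm (coords F u) (F'ᵀ 0) := by
    intro u hu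
    have h := hK _ (mem_hullCone hu (hF.descartesForm_coords_self u))
    rwa [hF.descartesForm_coords_zero] at h
  have hp := hF'.descartesForm_curv_pos hz (hF.coords_sum_pos z)
  have hq := hF'.descartesForm_curv_pos hw (hF.coords_sum_pos w)
  have h := dist_sq_eq_descartesForm hF' (pointOf F' (coords F z)) (pointOf F' (coords F w))
  rw [hF'.coords_pointOf (hF.descartesForm_coords_self z) hp.ne',
    hF'.coords_pointOf (hF.descartesForm_coords_self w) hq.ne', descartesForm_smul,
    descartesForm_smul_right, ← dist_sq_eq_descartesForm hF] at h
  have hz4 := hlow z hz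
  have hw4 := hlow w hw
  set p := descartesForm (coords F z) (F'ᵀ 0)
  set q := descartesForm (coords F w) (F'ᵀ 0)
  have hzK : 4 / p ≤ K := (div_le_iff₀ hp).2 hz4
  have hwK : 4 / q ≤ K := (div_le_iff₀ hq).2 hw4
  have hpq : 4 / p * (4 / q) ≤ K * K :=
    mul_le_mul hzK hwK (by positivity) K.2
  refine abs_le_of_sq_le_sq' ?_ (by positivity) |>.2
  nlinarith [mul_le_mul_of_nonneg_right hpq (sq_nonneg (dist z w))]

theorem AG_subset_image (hF : IsFrame F) (hF' : IsFrame F') (hR : Represents F 𝒟)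
    (hR' : Represents F' 𝒟') : AG 𝒟' ⊆ (fun z => pointOf F' (coords F z)) '' AG 𝒟 := by
  rw [hF.AG_eq hR, hF'.AG_eq hR']
  intro z hz
  have hpos := hF.descartesForm_curv_pos hz.1 (hF'.coords_sum_pos z)
  have h := hF.coords_pointOf (hF'.descartesForm_coords_self z) hpos.ne'
  refine ⟨pointOf F (coords F' z), ?_, ?_⟩
  · show coords F _ ∈ gasketCone
    rw [h]
    exact smul_mem_gasketCone (by positivity) hz
  · simp only
    rw [h, pointOf_smul _ (by positivity), hF'.pointOf_coords]

theorem hausdorffMeasure_AG_le (hF : IsFrame F) (hF' : IsFrame F') (hR : Represents F 𝒟)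
    (hR' : Represents F' 𝒟')
    (hK : ∀ x ∈ hullCone, descartesForm x (Fᵀ 0) ≤ K * descartesForm x (F'ᵀ 0)) {s : ℝ}
    (hs : 0 ≤ s) : μH[s] (AG 𝒟') ≤ (K : ℝ≥0∞) ^ s * μH[s] (AG 𝒟) := by
  refine (measure_mono (AG_subset_image hF hF' hR hR')).trans ?_
  refine LipschitzOnWith.hausdorffMeasure_image_le ?_ hs
  refine (lipschitzOnWith_pointOf_coords hF hF' hK).mono ?_
  rw [hF.AG_eq hR]
  exact fun z hz => hz.1

end Comparison

theorem dAG_nonneg : 0 ≤ dAG := ENNReal.toReal_nonneg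

theorem hausdorffMeasure_tripleOf_le {ε : ℝ} (hε : 0 < ε) {g g' : Fin 4 → ℝ}
    (hg : g ∈ GammaEps ε) (hg' : g' ∈ GammaEps ε) (w : Word) :
    μH[dAG] (AG (tripleOf (g' ᵥ* Mword w))) ≤
      ENNReal.ofReal (6 * ε⁻¹ ^ 2) ^ dAG * μH[dAG] (AG (tripleOf (g ᵥ* Mword w))) := by
  obtain ⟨F, hF, hR, e⟩ :=
    exists_isFrame_tripleOf (vecMul_Mword_mem_Gamma (GammaEps_subset_Gamma hε hg) w)
  obtain ⟨F', hF', hR', e'⟩ :=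
    exists_isFrame_tripleOf (vecMul_Mword_mem_Gamma (GammaEps_subset_Gamma hε hg') w)
  refine hausdorffMeasure_AG_le hF hF' hR hR' (fun x hx => ?_) dAG_nonneg
  obtain ⟨y, hy, hxy⟩ := exists_descartesForm_vecMul_Mword w hx
  rw [e, e', hxy, hxy, Real.coe_toNNReal _ (by positivity)]
  exact descartesForm_le_of_mem_GammaEps hε hg hg' hy

end Apollonian

/-- comparability of `ℋ_Γ(g₁M_w)` and `ℋ_Γ(g₂M_w)`. -/
theorem HGamma_Mword_comparable :
    ∃ c₂ : ℝ, 0 < c₂ ∧ ∀ ε : ℝ, ε ∈ Set.Ioo (0:ℝ) 1 →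
      ∀ g₁ ∈ GammaEps ε, ∀ g₂ ∈ GammaEps ε, ∀ w : Word,
        HGamma (Matrix.vecMul g₂ (Mword w)) ≤
          c₂ * ε ^ (-(15 * dAG)) * HGamma (Matrix.vecMul g₁ (Mword w)) := by
  refine ⟨6 ^ dAG, by positivity, fun ε hε g₁ hg₁ g₂ hg₂ w => ?_⟩
  obtain ⟨hε0, hε1⟩ := hε
  have h₁ := Apollonian.hausdorffMeasure_tripleOf_le hε0 hg₁ hg₂ w
  have h₂ := Apollonian.hausdorffMeasure_tripleOf_le hε0 hg₂ hg₁ w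
  have hd := Apollonian.dAG_nonneg
  have hC : ENNReal.ofReal (6 * ε⁻¹ ^ 2) ^ dAG ≠ ⊤ :=
    ENNReal.rpow_ne_top_of_nonneg hd ENNReal.ofReal_ne_top
  have hreal : HGamma (g₂ ᵥ* Mword w) ≤
      (6 * ε⁻¹ ^ 2) ^ dAG * HGamma (g₁ ᵥ* Mword w) := by
    rw [HGamma, HGamma]
    by_cases htop : μH[dAG] (AG (tripleOf (g₁ ᵥ* Mword w))) = ⊤
    · rw [htop, top_le_iff] at h₂
      rcases ENNReal.mul_eq_top.1 h₂ with h | h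
      · rw [h.2, htop]; simp
      · exact absurd h.1 hC
    · have h := ENNReal.toReal_mono (ENNReal.mul_ne_top hC htop) h₁
      rwa [ENNReal.toReal_mul, ← ENNReal.toReal_rpow,
        ENNReal.toReal_ofReal (by positivity)] at h
  refine hreal.trans (mul_le_mul_of_nonneg_right ?_ ENNReal.toReal_nonneg)
  rw [Real.mul_rpow (by norm_num) (by positivity)]
  refine mul_le_mul_of_nonneg_left ?_ (by positivity)
  rw [← Real.rpow_natCast, ← Real.rpow_neg_one, ← Real.rpow_mul hε0.le, ← Real.rpow_mul hε0.le]
  refine Real.rpow_le_rpow_of_exponent_ge hε0 hε1.le ?_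
  push_cast
  linarith
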